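/- arXiv:1705.03238 — 10 statements merged into one kernel-verified Lean document; each statement's English description precedes it below -/
import Mathlib

section
/- Let X be a k-complete topologized semilattice and let Y be a topological band, i.e., a semigroup endowed with a topology in which the multiplication (y,y') ↦ yy' is jointly continuous and every element is idempotent (yy = y for all y ∈ Y). Then every upper semicontinuous T₂-multimorphism Φ : X ⊸ Y has θ-closed image Φ(X) = ⋃_{x∈X} Φ(x) in Y. -/
open Set Topology

/-- A topologized semilattice `X` is *k-complete* if every nonempty chain `C ⊆ X` has a
greatest lower bound and a least upper bound, both belonging to the closure of `C`. -/
def KComplete (X : Type*) [SemilatticeInf X] [TopologicalSpace X] : Prop :=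
  ∀ C : Set X, C.Nonempty → IsChain (· ≤ ·) C →
    (∃ a, IsGLB C a ∧ a ∈ closure C) ∧ ∃ b, IsLUB C b ∧ b ∈ closure C

/-- A set `A` is *θ-closed* if every point outside `A` has a closed neighborhood
disjoint from `A`. -/
def ThetaClosed {Y : Type*} [TopologicalSpace Y] (A : Set Y) : Prop :=
  ∀ y ∉ A, ∃ N : Set Y, N ∈ nhds y ∧ IsClosed N ∧ N ∩ A = ∅

theorem aux_glb {X : Type*} [SemilatticeInf X] [TopologicalSpace X] (hX : KComplete X)
    {L : Set X} (hL : IsClosed L) {C : Set X} (hC : C.Nonempty) (hch : IsChain (· ≤ ·) C)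
    (hCL : C ⊆ L) : ∃ a, IsGLB C a ∧ a ∈ L := by
  obtain ⟨⟨a, ha, hac⟩, -⟩ := hX C hC hch
  exact ⟨a, ha, closure_minimal hCL hL hac⟩

theorem aux_lub {X : Type*} [SemilatticeInf X] [TopologicalSpace X] (hX : KComplete X)
    {L : Set X} (hL : IsClosed L) {C : Set X} (hC : C.Nonempty) (hch : IsChain (· ≤ ·) C)
    (hCL : C ⊆ L) : ∃ a, IsLUB C a ∧ a ∈ L := by
  obtain ⟨-, ⟨a, ha, hac⟩⟩ := hX C hC hch
  exact ⟨a, ha, closure_minimal hCL hL hac⟩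

/-- Least element of `L` above `x`. -/
theorem aux_least {X : Type*} [SemilatticeInf X] [TopologicalSpace X] (hX : KComplete X)
    {L : Set X} (hL : IsClosed L) (hinf : ∀ a ∈ L, ∀ b ∈ L, a ⊓ b ∈ L) (x : X)
    (hne : ∃ a ∈ L, x ≤ a) : ∃ a, IsLeast {a | a ∈ L ∧ x ≤ a} a := by
  obtain ⟨a₀, ha₀, hxa₀⟩ := hne
  obtain ⟨m, hm⟩ := zorn_le₀ (α := Xᵒᵈ) {a : Xᵒᵈ | OrderDual.ofDual a ∈ L ∧ x ≤ OrderDual.ofDual a}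
    (by
      intro c hc hch
      rcases c.eq_empty_or_nonempty with rfl | hcne
      · exact ⟨OrderDual.toDual a₀, ⟨ha₀, hxa₀⟩, by simp⟩
      · have hch' : IsChain (· ≤ ·) (OrderDual.toDual ⁻¹' c : Set X) := by
          intro a ha b hb hab
          exact (hch ha hb hab).symm
        obtain ⟨g, hg, hgL⟩ := aux_glb hX hL (C := (OrderDual.toDual ⁻¹' c : Set X)) hcne hch'
          (fun a ha => (hc ha).1)
        exact ⟨OrderDual.toDual g, ⟨hgL, hg.2 (fun a ha => (hc ha).2)⟩, fun z hz => hg.1 hz⟩)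
  refine ⟨OrderDual.ofDual m, hm.1, ?_⟩
  intro b hb
  have h1 : OrderDual.ofDual m ⊓ b ∈ L ∧ x ≤ OrderDual.ofDual m ⊓ b :=
    ⟨hinf _ hm.1.1 _ hb.1, le_inf hm.1.2 hb.2⟩
  have h2 : OrderDual.ofDual m ≤ OrderDual.ofDual m ⊓ b :=
    hm.2 (y := OrderDual.toDual (OrderDual.ofDual m ⊓ b)) h1 (inf_le_left (a := OrderDual.ofDual m))
  exact h2.trans inf_le_right

theorem aux_directed {X ι : Type*} [SemilatticeInf X] [TopologicalSpace X] (hX : KComplete X)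
    [Nonempty ι] (L : ι → Set X) (hL : ∀ s, IsClosed (L s)) (hne : ∀ s, (L s).Nonempty)
    (hinf : ∀ s, ∀ a ∈ L s, ∀ b ∈ L s, a ⊓ b ∈ L s)
    (hdir : ∀ s t, ∃ r, L r ⊆ L s ∧ L r ⊆ L t) : ∃ m, ∀ s, m ∈ L s := by
  classical
  let A : Set X := {x | ∀ s, ∃ a ∈ L s, x ≤ a}
  have hleast : ∀ s, ∀ x : A, ∃ a, IsLeast {a | a ∈ L s ∧ x.1 ≤ a} a := fun s x =>
    aux_least hX (hL s) (hinf s) x.1 (x.2 s)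
  choose f hf using hleast
  have hmono : ∀ s, ∀ x y : A, x.1 ≤ y.1 → f s x ≤ f s y := fun s x y h =>
    (hf s x).2 ⟨(hf s y).1.1, h.trans (hf s y).1.2⟩
  have hfA : ∀ s x, f s x ∈ A := by
    intro s x t
    obtain ⟨r, hrs, hrt⟩ := hdir s t
    exact ⟨f r x, hrt (hf r x).1.1, (hf s x).2 ⟨hrs (hf r x).1.1, (hf r x).1.2⟩⟩
  have hAne : A.Nonempty := by
    obtain ⟨s₀⟩ := ‹Nonempty ι›
    obtain ⟨p, hp⟩ := hne s₀
    obtain ⟨g, hg⟩ : ∃ g, IsLeast (L s₀) g := by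
      obtain ⟨m, hm⟩ := zorn_le₀ (α := Xᵒᵈ) {a : Xᵒᵈ | OrderDual.ofDual a ∈ L s₀}
        (by
          intro c hc hch
          rcases c.eq_empty_or_nonempty with rfl | hcne
          · exact ⟨OrderDual.toDual p, hp, by simp⟩
          · have hch' : IsChain (· ≤ ·) (OrderDual.toDual ⁻¹' c : Set X) := by
              intro a ha b hb hab
              exact (hch ha hb hab).symm
            obtain ⟨g, hg, hgL⟩ := aux_glb hX (hL s₀)
              (C := (OrderDual.toDual ⁻¹' c : Set X)) hcne hch' (fun a ha => hc ha)
            exact ⟨OrderDual.toDual g, hgL, fun z hz => hg.1 hz⟩)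
      refine ⟨OrderDual.ofDual m, hm.1, ?_⟩
      intro b hb
      have h2 : OrderDual.ofDual m ≤ OrderDual.ofDual m ⊓ b :=
        hm.2 (y := OrderDual.toDual (OrderDual.ofDual m ⊓ b)) (hinf _ _ hm.1 _ hb)
          (inf_le_left (a := OrderDual.ofDual m))
      exact h2.trans inf_le_right
    refine ⟨g, fun t => ?_⟩
    obtain ⟨r, hrs, hrt⟩ := hdir s₀ t
    obtain ⟨q, hq⟩ := hne r
    exact ⟨q, hrt hq, hg.2 (hrs hq)⟩
  obtain ⟨m, hm⟩ := zorn_le₀ A (by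
    intro c hc hch
    rcases c.eq_empty_or_nonempty with rfl | hcne
    · obtain ⟨a, ha⟩ := hAne
      exact ⟨a, ha, by simp⟩
    · obtain ⟨-, u, hu, -⟩ := hX c hcne hch
      refine ⟨u, fun s => ?_, fun z hz => hu.1 hz⟩
      obtain ⟨x₀, hx₀⟩ := hcne
      obtain ⟨v, hv, hvL⟩ := aux_lub hX (hL s)
        (C := Set.range fun x : c => f s ⟨x.1, hc x.2⟩) ⟨_, ⟨x₀, hx₀⟩, rfl⟩
        (by
          rintro _ ⟨x, rfl⟩ _ ⟨y, rfl⟩ -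
          rcases hch.total x.2 y.2 with h | h
          · exact Or.inl (hmono s _ _ h)
          · exact Or.inr (hmono s _ _ h))
        (by rintro _ ⟨x, rfl⟩; exact (hf s _).1.1)
      exact ⟨v, hvL, hu.2 fun x hx => ((hf s ⟨x, hc hx⟩).1.2).trans (hv.1 ⟨⟨x, hx⟩, rfl⟩)⟩)
  refine ⟨m, fun s => ?_⟩
  have h1 := (hf s ⟨m, hm.1⟩).1
  have h2 : f s ⟨m, hm.1⟩ ≤ m := hm.2 (hfA s _) h1.2
  have h3 : f s ⟨m, hm.1⟩ = m := le_antisymm h2 h1.2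
  have h4 : f s ⟨m, hm.1⟩ ∈ L s := h1.1
  rwa [h3] at h4

/-- Partial meets `x n ⊓ ... ⊓ x (n+k)`. -/
def auxW {X : Type*} [SemilatticeInf X] (x : ℕ → X) : ℕ → ℕ → X
  | 0, n => x n
  | k + 1, n => x n ⊓ auxW x k (n + 1)

theorem aux_seq {X : Type*} [SemilatticeInf X] [TopologicalSpace X] (hX : KComplete X)
    (P : ℕ → Set X) (hP : ∀ n, IsClosed (P n)) (hne : ∀ n, (P n).Nonempty)
    (hinf : ∀ n, ∀ a ∈ P (n + 1), ∀ b ∈ P (n + 1), a ⊓ b ∈ P n) : (⋂ n, P n).Nonempty := by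
  have hsub : ∀ n, P (n + 1) ⊆ P n := fun n a ha => by
    simpa using hinf n a ha a ha
  choose x hx using hne
  have hw : ∀ k n, auxW x k (n + 1) ∈ P n := by
    intro k
    induction k with
    | zero => exact fun n => hsub n (hx _)
    | succ k ih => exact fun n => hinf n _ (hx _) _ (ih (n + 1))
  have hanti : ∀ k n, auxW x (k + 1) n ≤ auxW x k n := by
    intro k
    induction k with
    | zero => exact fun n => inf_le_left
    | succ k ih => exact fun n => inf_le_inf_left _ (ih (n + 1))
  have hz : ∀ n, ∃ a, IsGLB (Set.range fun k => auxW x k (n + 1)) a ∧ a ∈ P n := fun n =>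
    aux_glb hX (hP n) ⟨_, 0, rfl⟩
      (antitone_nat_of_succ_le fun k => hanti k (n + 1)).isChain_range
      (by rintro _ ⟨k, rfl⟩; exact hw k n)
  choose z hz hzP using hz
  have hzm : Monotone z := monotone_nat_of_le_succ fun n => (hz (n + 1)).2 (by
    rintro _ ⟨k, rfl⟩
    exact ((hz n).1 ⟨k + 1, rfl⟩).trans (inf_le_right : auxW x (k + 1) (n + 1) ≤ _))
  have hPa : Antitone P := antitone_nat_of_succ_le hsub
  obtain ⟨-, v, hv, -⟩ := hX (Set.range z) ⟨_, 0, rfl⟩ hzm.isChain_range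
  refine ⟨v, Set.mem_iInter.2 fun N => ?_⟩
  have hzN : Monotone fun n => z (N + n) := fun a b h => hzm (by omega)
  obtain ⟨u, hu, huP⟩ := aux_lub hX (hP N) (C := Set.range fun n => z (N + n)) ⟨_, 0, rfl⟩
    hzN.isChain_range
    (by rintro _ ⟨k, rfl⟩; exact hPa (Nat.le_add_right N k) (hzP _))
  have : u = v := by
    apply le_antisymm
    · exact hu.2 (by rintro _ ⟨k, rfl⟩; exact hv.1 ⟨_, rfl⟩)
    · exact hv.2 (by
        rintro _ ⟨k, rfl⟩
        exact (hzm (Nat.le_add_left k N)).trans (hu.1 ⟨k, rfl⟩))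
  exact this ▸ huP

/-- Every upper semicontinuous `T₂`-multimorphism from a k-complete topologized semilattice
to a topological band has θ-closed image. -/
theorem stmt0 {X Y : Type*} [SemilatticeInf X] [TopologicalSpace X]
    [Semigroup Y] [TopologicalSpace Y]
    (hXk : KComplete X)
    (hYcont : Continuous fun p : Y × Y => p.1 * p.2)
    (hYband : ∀ y : Y, y * y = y)
    (Φ : X → Set Y)
    (hmul : ∀ x x' : X, ∀ y ∈ Φ x, ∀ y' ∈ Φ x', y * y' ∈ Φ (x ⊓ x'))
    (husc : ∀ F : Set Y, IsClosed F → IsClosed {x : X | (Φ x ∩ F).Nonempty})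
    (hT2 : ∀ x : X, ThetaClosed (Φ x)) :
    ThetaClosed (⋃ x : X, Φ x) := by
  classical
  intro y hy
  by_contra hcon
  push Not at hcon
  let Q : Set Y → Set X := fun U => {x : X | (Φ x ∩ closure U).Nonempty}
  have hQc : ∀ U, IsClosed (Q U) := fun U => husc _ isClosed_closure
  have hQne : ∀ U ∈ nhds y, (Q U).Nonempty := by
    intro U hU
    obtain ⟨p, hp, hpΦ⟩ :=
      hcon (closure U) (Filter.mem_of_superset hU subset_closure) isClosed_closure
    obtain ⟨x, hx⟩ := Set.mem_iUnion.1 hpΦ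
    exact ⟨x, p, hx, hp⟩
  have hQmul : ∀ U V : Set Y, (∀ a ∈ V, ∀ b ∈ V, a * b ∈ U) →
      ∀ x ∈ Q V, ∀ x' ∈ Q V, x ⊓ x' ∈ Q U := by
    rintro U V h x ⟨a, ha, haV⟩ x' ⟨b, hb, hbV⟩
    exact ⟨a * b, hmul _ _ _ ha _ hb, map_mem_closure₂ hYcont haV hbV h⟩
  have hstep : ∀ U : {U : Set Y // U ∈ nhds y}, ∃ V : {U : Set Y // U ∈ nhds y},
      ∀ a ∈ V.1, ∀ b ∈ V.1, a * b ∈ U.1 := by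
    rintro ⟨U, hU⟩
    have h1 : (fun p : Y × Y => p.1 * p.2) ⁻¹' U ∈ nhds (y, y) :=
      hYcont.continuousAt (by simpa [hYband y] using hU)
    rw [nhds_prod_eq, Filter.mem_prod_same_iff] at h1
    obtain ⟨V, hV, hVU⟩ := h1
    exact ⟨⟨V, hV⟩, fun a ha b hb => hVU (Set.mk_mem_prod ha hb)⟩
  choose g hg using hstep
  let ι := {U : ℕ → Set Y // (∀ n, U n ∈ nhds y) ∧
    ∀ n, ∀ a ∈ U (n + 1), ∀ b ∈ U (n + 1), a * b ∈ U n}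
  have hex : ∀ U ∈ nhds y, ∃ s : ι, s.1 0 = U := by
    intro U hU
    refine ⟨⟨fun n => (g^[n] ⟨U, hU⟩).1, fun n => (g^[n] ⟨U, hU⟩).2, fun n => ?_⟩, rfl⟩
    simp only [Function.iterate_succ_apply']
    exact hg _
  have : Nonempty ι := ⟨(hex _ Filter.univ_mem).choose⟩
  have hQmono : ∀ U V : Set Y, U ⊆ V → Q U ⊆ Q V := fun U V h x hx =>
    hx.mono (Set.inter_subset_inter_right _ (closure_mono h))
  obtain ⟨m, hm⟩ := aux_directed hXk (fun s : ι => ⋂ n, Q (s.1 n))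
    (fun s => isClosed_iInter fun n => hQc _)
    (fun s => aux_seq hXk _ (fun n => hQc _) (fun n => hQne _ (s.2.1 n))
      (fun n => hQmul _ _ (s.2.2 n)))
    (fun s a ha b hb => Set.mem_iInter.2 fun n =>
      hQmul _ _ (s.2.2 n) a (Set.mem_iInter.1 ha _) b (Set.mem_iInter.1 hb _))
    (fun s t => ⟨⟨fun n => s.1 n ∩ t.1 n, fun n => Filter.inter_mem (s.2.1 n) (t.2.1 n),
        fun n a ha b hb => ⟨s.2.2 n a ha.1 b hb.1, t.2.2 n a ha.2 b hb.2⟩⟩,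
      Set.iInter_mono fun n => hQmono _ _ Set.inter_subset_left,
      Set.iInter_mono fun n => hQmono _ _ Set.inter_subset_right⟩)
  have hym : y ∉ Φ m := fun h => hy (Set.mem_iUnion.2 ⟨m, h⟩)
  obtain ⟨N, hN, hNc, hdis⟩ := hT2 m y hym
  obtain ⟨s, hs⟩ := hex N hN
  obtain ⟨p, hp, hpN⟩ := Set.mem_iInter.1 (hm s) 0
  rw [hs, hNc.closure_eq] at hpN
  exact (Set.eq_empty_iff_forall_notMem.1 hdis p) ⟨hpN, hp⟩
end

section
/- Let X be a k-complete topologized semilattice, let Y be a semigroup endowed with a topology, and let Φ : X ⊸ Y be an upper semicontinuous multimorphism. Let y ∈ Y be a point such that every closed neighborhood of y in Y intersects Φ(X). Then for any decreasing sequence (U_n)_{n∈ω} of closed neighborhoods of y in Y satisfying U_{n+1}·U_{n+1} ⊆ U_n for all n ∈ ω, the set ⋂_{n∈ω} Φ⁻¹(U_n) is a nonempty closed subsemilattice of X. -/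
open Set Topology

/-- Lemma: for a k-complete topologized semilattice `X`, a semigroup `Y` with a topology,
an upper semicontinuous multimorphism `Φ : X ⊸ Y` and a point `y ∈ Y` all of whose closed
neighborhoods meet `Φ(X)`, the intersection `⋂ₙ Φ⁻¹(Uₙ)` along a decreasing sequence of
closed neighborhoods of `y` with `U_{n+1}·U_{n+1} ⊆ U_n` is a nonempty closed
subsemilattice of `X`. -/
theorem stmt1 {X Y : Type*} [SemilatticeInf X] [TopologicalSpace X]
    [Semigroup Y] [TopologicalSpace Y]
    (hXk : KComplete X)
    (Φ : X → Set Y)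
    (hmul : ∀ x x' : X, ∀ y ∈ Φ x, ∀ y' ∈ Φ x', y * y' ∈ Φ (x ⊓ x'))
    (husc : ∀ F : Set Y, IsClosed F → IsClosed {x : X | (Φ x ∩ F).Nonempty})
    (y : Y)
    (hy : ∀ N : Set Y, N ∈ nhds y → IsClosed N → (N ∩ ⋃ x : X, Φ x).Nonempty)
    (U : ℕ → Set Y)
    (hUnhd : ∀ n : ℕ, U n ∈ nhds y)
    (hUcl : ∀ n : ℕ, IsClosed (U n))
    (hUdec : ∀ n : ℕ, U (n + 1) ⊆ U n)
    (hUmul : ∀ n : ℕ, ∀ a ∈ U (n + 1), ∀ b ∈ U (n + 1), a * b ∈ U n) :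
    (⋂ n : ℕ, {x : X | (Φ x ∩ U n).Nonempty}).Nonempty ∧
    IsClosed (⋂ n : ℕ, {x : X | (Φ x ∩ U n).Nonempty}) ∧
    ∀ a ∈ ⋂ n : ℕ, {x : X | (Φ x ∩ U n).Nonempty},
      ∀ b ∈ ⋂ n : ℕ, {x : X | (Φ x ∩ U n).Nonempty},
        a ⊓ b ∈ ⋂ n : ℕ, {x : X | (Φ x ∩ U n).Nonempty} := by
  have hcl : ∀ n, IsClosed {x : X | (Φ x ∩ U n).Nonempty} := fun n => husc _ (hUcl n)
  have hinf : ∀ n a b, (Φ a ∩ U (n + 1)).Nonempty → (Φ b ∩ U (n + 1)).Nonempty →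
      (Φ (a ⊓ b) ∩ U n).Nonempty := by
    rintro n a b ⟨u, hu, hu'⟩ ⟨v, hv, hv'⟩
    exact ⟨u * v, hmul a b u hu v hv, hUmul n u hu' v hv'⟩
  have hdec : ∀ n a, (Φ a ∩ U (n + 1)).Nonempty → (Φ a ∩ U n).Nonempty := by
    rintro n a ⟨u, hu, hu'⟩
    exact ⟨u, hu, hUdec n hu'⟩
  have hdec' : ∀ k n a, (Φ a ∩ U (n + k)).Nonempty → (Φ a ∩ U n).Nonempty := by
    intro k
    induction k with
    | zero => intro n a h; exact h
    | succ k ih => intro n a h; exact ih n a (hdec (n + k) a h)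
  refine ⟨?_, isClosed_iInter hcl, ?_⟩
  · have hx : ∀ n, ∃ x : X, (Φ x ∩ U (n + 1)).Nonempty := by
      intro n
      obtain ⟨v, hv, hv'⟩ := hy (U (n + 1)) (hUnhd _) (hUcl _)
      obtain ⟨x, hx⟩ := mem_iUnion.1 hv'
      exact ⟨x, v, hx, hv⟩
    choose x hx using hx
    let p : ℕ → ℕ → X := fun n k =>
      Nat.rec (motive := fun _ => ℕ → X) (fun n => x n) (fun _ f n => x n ⊓ f (n + 1)) k n
    have p0 : ∀ n, p n 0 = x n := fun n => rfl
    have ps : ∀ n k, p n (k + 1) = x n ⊓ p (n + 1) k := fun n k => rfl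
    clear_value p
    have hp : ∀ k n, (Φ (p n k) ∩ U n).Nonempty := by
      intro k
      induction k with
      | zero => intro n; rw [p0]; exact hdec n _ (hx n)
      | succ k ih => intro n; rw [ps]; exact hinf n _ _ (hx n) (ih (n + 1))
    have hanti : ∀ k n, p n (k + 1) ≤ p n k := by
      intro k
      induction k with
      | zero => intro n; rw [ps, p0 n]; exact inf_le_left
      | succ k ih => intro n; rw [ps, ps n k]; exact inf_le_inf_left _ (ih (n + 1))
    have hz : ∀ n, ∃ z, IsGLB (range (p n)) z ∧ z ∈ closure (range (p n)) := fun n =>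
      (hXk _ (range_nonempty _)
        (antitone_nat_of_succ_le (fun k => hanti k n)).isChain_range).1
    choose z hz hzc using hz
    have hzA : ∀ n, (Φ (z n) ∩ U n).Nonempty := fun n =>
      closure_minimal (t := {x : X | (Φ x ∩ U _).Nonempty}) (range_subset_iff.2 fun k => hp k n) (hcl n) (hzc n)
    have hmono : Monotone z := by
      refine monotone_nat_of_le_succ fun n => (hz (n + 1)).2 ?_
      rintro _ ⟨k, rfl⟩
      exact ((hz n).1 ⟨k + 1, rfl⟩).trans ((ps n k).le.trans inf_le_right)
    have hb : ∀ k, ∃ b, IsLUB (range fun n => z (k + n)) b ∧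
        b ∈ closure (range fun n => z (k + n)) := fun k =>
      (hXk _ (range_nonempty _)
        (Monotone.isChain_range fun i j h => hmono (Nat.add_le_add_left h k))).2
    choose b hb hbc using hb
    have hbe : ∀ k, b k = b 0 := by
      intro k
      apply le_antisymm
      · refine (hb k).2 ?_
        rintro _ ⟨n, rfl⟩
        exact (hb 0).1 ⟨k + n, by simp⟩
      · refine (hb 0).2 ?_
        rintro _ ⟨n, rfl⟩
        exact (hmono (by omega : 0 + n ≤ k + n)).trans ((hb k).1 ⟨n, rfl⟩)
    refine ⟨b 0, mem_iInter.2 fun k => ?_⟩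
    rw [← hbe k]
    exact closure_minimal (t := {x : X | (Φ x ∩ U _).Nonempty}) (range_subset_iff.2 fun n => hdec' n k _ (hzA (k + n))) 
      (hcl k) (hbc k)
  · intro a ha b hb
    rw [mem_iInter] at ha hb ⊢
    exact fun n => hinf n a b (ha (n + 1)) (hb (n + 1))
end

section
/- Let X be a k-complete topologized semilattice and let Y be a topological semilattice satisfying the separation axiom T₁ (the meet operation of Y is jointly continuous and all singletons of Y are closed). Then every upper semicontinuous T₂-multimorphism Φ : X ⊸ Y has closed image Φ(X) = ⋃_{x∈X} Φ(x) in Y. -/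
open Set Topology

/-- A closed subsemilattice of a k-complete semilattice has a least element above any
given lower point. -/
lemma exists_least_above {X : Type*} [SemilatticeInf X] [TopologicalSpace X]
    (hXk : KComplete X) (S : Set X) (hS : IsClosed S)
    (hinf : ∀ a ∈ S, ∀ b ∈ S, a ⊓ b ∈ S) (x : X) (hx : ∃ s ∈ S, x ≤ s) :
    ∃ m ∈ S, x ≤ m ∧ ∀ s ∈ S, x ≤ s → m ≤ s := by
  obtain ⟨s0, hs0, hxs0⟩ := hx
  obtain ⟨m, hm⟩ := zorn_le₀ (α := Xᵒᵈ) {t : Xᵒᵈ | OrderDual.ofDual t ∈ S ∧ x ≤ OrderDual.ofDual t} (by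
    intro c hc hchain
    rcases c.eq_empty_or_nonempty with rfl | hne
    · exact ⟨OrderDual.toDual s0, ⟨hs0, hxs0⟩, by simp⟩
    · obtain ⟨⟨a, ha, hac⟩, -⟩ := hXk (OrderDual.toDual ⁻¹' c) hne (by
        intro u hu v hv huv
        exact (hchain hu hv huv).symm)
      refine ⟨OrderDual.toDual a, ⟨?_, ?_⟩, ?_⟩
      · exact closure_minimal (fun t ht => (hc ht).1) hS hac
      · exact ha.2 (fun t ht => (hc ht).2)
      · intro z hz
        exact ha.1 hz)
  refine ⟨OrderDual.ofDual m, hm.1.1, hm.1.2, fun s hs hxs => ?_⟩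
  have h1 : OrderDual.ofDual m ⊓ s ∈ S := hinf _ hm.1.1 _ hs
  have h2 : x ≤ OrderDual.ofDual m ⊓ s := le_inf hm.1.2 hxs
  have h3 := hm.2 (y := OrderDual.toDual (OrderDual.ofDual m ⊓ s)) ⟨h1, h2⟩
    (show OrderDual.ofDual m ⊓ s ≤ OrderDual.ofDual m from inf_le_left)
  have h4 : OrderDual.ofDual m ≤ OrderDual.ofDual m ⊓ s := h3
  exact h4.trans inf_le_right

/-- A filter base of nonempty closed subsemilattices of a k-complete semilattice has a
common point. -/
lemma exists_common {X ι : Type*} [SemilatticeInf X] [TopologicalSpace X]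
    (hXk : KComplete X) [Nonempty X] (S : ι → Set X) (hS : ∀ i, IsClosed (S i))
    (hinf : ∀ i, ∀ a ∈ S i, ∀ b ∈ S i, a ⊓ b ∈ S i) (hne : ∀ i, (S i).Nonempty)
    (hdir : ∀ i j, ∃ k, S k ⊆ S i ∩ S j) : ∃ x, ∀ i, x ∈ S i := by
  obtain ⟨b, -, -, hb⟩ := exists_least_above hXk univ isClosed_univ (by simp)
    (Classical.arbitrary X) ⟨_, mem_univ _, le_rfl⟩
  obtain ⟨b, hb⟩ : ∃ b : X, ∀ i, ∃ s ∈ S i, b ≤ s := by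
    obtain ⟨⟨m, hm⟩⟩ : Nonempty {m : X // ∀ x, m ≤ x} := by
      obtain ⟨m, hm⟩ := zorn_le₀ (α := Xᵒᵈ) univ (by
        intro c hc hchain
        rcases c.eq_empty_or_nonempty with rfl | hne
        · exact ⟨OrderDual.toDual b, mem_univ _, by simp⟩
        · obtain ⟨⟨a, ha, hac⟩, -⟩ := hXk (OrderDual.toDual ⁻¹' c) hne (by
            intro u hu v hv huv
            exact (hchain hu hv huv).symm)
          exact ⟨OrderDual.toDual a, mem_univ _, fun z hz => ha.1 hz⟩)
      refine ⟨⟨OrderDual.ofDual m, fun s => ?_⟩⟩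
      have h3 := hm.2 (y := OrderDual.toDual (OrderDual.ofDual m ⊓ s)) (mem_univ _)
        (show OrderDual.ofDual m ⊓ s ≤ OrderDual.ofDual m from inf_le_left)
      have h4 : OrderDual.ofDual m ≤ OrderDual.ofDual m ⊓ s := h3
      exact h4.trans inf_le_right
    exact ⟨m, fun i => ⟨_, (hne i).some_mem, hm _⟩⟩
  obtain ⟨x, hx⟩ := zorn_le₀ {x : X | ∀ i, ∃ s ∈ S i, x ≤ s} (by
    intro c hc hchain
    rcases c.eq_empty_or_nonempty with rfl | hcne
    · exact ⟨b, hb, by simp⟩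
    · obtain ⟨-, w, hw, -⟩ := hXk c hcne hchain
      refine ⟨w, fun i => ?_, fun z hz => hw.1 hz⟩
      have key : ∀ x : c, ∃ m ∈ S i, (x : X) ≤ m ∧ ∀ s ∈ S i, (x : X) ≤ s → m ≤ s :=
        fun x => exists_least_above hXk (S i) (hS i) (hinf i) x (hc x.2 i)
      choose f hf1 hf2 hf3 using key
      have hmono : ∀ u v : c, (u : X) ≤ v → f u ≤ f v := fun u v huv =>
        hf3 u _ (hf1 v) (huv.trans (hf2 v))
      have : Nonempty c := hcne.to_subtype
      obtain ⟨-, q, hq, hqc⟩ := hXk (range f) (range_nonempty f) (by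
        rintro _ ⟨u, rfl⟩ _ ⟨v, rfl⟩ -
        rcases hchain.total u.2 v.2 with h | h
        · exact Or.inl (hmono _ _ h)
        · exact Or.inr (hmono _ _ h))
      refine ⟨q, closure_minimal (range_subset_iff.2 hf1) (hS i) hqc, hw.2 fun z hz => ?_⟩
      exact (hf2 ⟨z, hz⟩).trans (hq.1 (mem_range_self _)))
  refine ⟨x, fun i => ?_⟩
  obtain ⟨m, hm1, hm2, hm3⟩ := exists_least_above hXk (S i) (hS i) (hinf i) x (hx.1 i)
  have hmP : m ∈ {x : X | ∀ i, ∃ s ∈ S i, x ≤ s} := by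
    intro j
    obtain ⟨k, hk⟩ := hdir i j
    obtain ⟨t, ht, hxt⟩ := hx.1 k
    exact ⟨t, (hk ht).2, hm3 t (hk ht).1 hxt⟩
  have : m = x := le_antisymm (hx.2 hmP hm2) hm2
  exact this ▸ hm1

/-- Finite meets `x n ⊓ ... ⊓ x (n + k)`. -/
def finMeet {X : Type*} [SemilatticeInf X] (x : ℕ → X) : ℕ → ℕ → X
  | 0, n => x n
  | k + 1, n => x n ⊓ finMeet x k (n + 1)

lemma finMeet_succ_le {X : Type*} [SemilatticeInf X] (x : ℕ → X) (k : ℕ) :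
    ∀ n, finMeet x (k + 1) n ≤ finMeet x k n := by
  induction k with
  | zero => exact fun n => inf_le_left
  | succ k ih => exact fun n => inf_le_inf_left _ (ih (n + 1))

/-- The liminf argument. -/
lemma exists_liminf {X : Type*} [SemilatticeInf X] [TopologicalSpace X]
    (hXk : KComplete X) (F : ℕ → Set X) (hF : ∀ n, IsClosed (F n)) (hanti : Antitone F)
    (x : ℕ → X) (hx : ∀ k n, finMeet x k (n + 1) ∈ F n) : ∃ w, ∀ n, w ∈ F n := by
  have hz : ∀ n, ∃ z, IsGLB (range fun k => finMeet x k n) z ∧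
      z ∈ closure (range fun k => finMeet x k n) := fun n =>
    (hXk _ (range_nonempty _)
      (antitone_nat_of_succ_le fun k => finMeet_succ_le x k n).isChain_range).1
  choose z hz1 hz2 using hz
  have hzm : Monotone z := monotone_nat_of_le_succ fun n => (hz1 (n + 1)).2 (by
    rintro _ ⟨k, rfl⟩
    exact ((hz1 n).1 (mem_range_self (k + 1))).trans inf_le_right)
  have hzF : ∀ n, z (n + 1) ∈ F n := fun n =>
    closure_minimal (range_subset_iff.2 fun k => hx k n) (hF n) (hz2 (n + 1))
  have hw : ∀ m, ∃ w, IsLUB (range fun n => z (n + m + 1)) w ∧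
      w ∈ closure (range fun n => z (n + m + 1)) := fun m =>
    (hXk _ (range_nonempty _) (Monotone.isChain_range fun a b h => hzm (by omega))).2
  choose w hw1 hw2 using hw
  have heq : ∀ m, w m = w 0 := by
    intro m
    apply le_antisymm
    · refine (hw1 m).2 ?_
      rintro _ ⟨n, rfl⟩
      exact (hw1 0).1 ⟨n + m, rfl⟩
    · refine (hw1 0).2 ?_
      rintro _ ⟨n, rfl⟩
      exact (hzm (by omega : n + 0 + 1 ≤ n + m + 1)).trans ((hw1 m).1 ⟨n, rfl⟩)
  refine ⟨w 0, fun m => ?_⟩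
  rw [← heq m]
  refine closure_minimal (range_subset_iff.2 fun n => ?_) (hF m) (hw2 m)
  exact hanti (by omega : m ≤ n + m) (hzF (n + m))

/-- Every upper semicontinuous `T₂`-multimorphism from a k-complete topologized semilattice
to a `T₁` topological semilattice has closed image. -/
theorem stmt2 {X Y : Type*} [SemilatticeInf X] [TopologicalSpace X]
    [SemilatticeInf Y] [TopologicalSpace Y] [T1Space Y]
    (hXk : KComplete X)
    (hYcont : Continuous fun p : Y × Y => p.1 ⊓ p.2)
    (Φ : X → Set Y)
    (hmul : ∀ x x' : X, ∀ y ∈ Φ x, ∀ y' ∈ Φ x', y ⊓ y' ∈ Φ (x ⊓ x'))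
    (husc : ∀ F : Set Y, IsClosed F → IsClosed {x : X | (Φ x ∩ F).Nonempty})
    (hT2 : ∀ x : X, ThetaClosed (Φ x)) :
    IsClosed (⋃ x : X, Φ x) := by
  refine isClosed_of_closure_subset fun y hy => ?_
  have hyN : ∀ V ∈ 𝓝 y, ∃ x, ∃ v ∈ Φ x, v ∈ V := by
    intro V hV
    obtain ⟨v, hvV, hv⟩ := mem_closure_iff_nhds.1 hy V hV
    obtain ⟨x, hx⟩ := mem_iUnion.1 hv
    exact ⟨x, v, hx, hvV⟩
  have : Nonempty X := ⟨(hyN univ Filter.univ_mem).choose⟩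
  have hstep : ∀ V : {V : Set Y // V ∈ 𝓝 y}, ∃ W : {W : Set Y // W ∈ 𝓝 y},
      ∀ a ∈ W.1, ∀ b ∈ W.1, a ⊓ b ∈ V.1 := by
    rintro ⟨V, hV⟩
    have h1 : (fun p : Y × Y => p.1 ⊓ p.2) ⁻¹' V ∈ 𝓝 (y, y) :=
      hYcont.continuousAt.preimage_mem_nhds (by simpa using hV)
    rw [nhds_prod_eq] at h1
    obtain ⟨W, hW, hWV⟩ := Filter.mem_prod_same_iff.1 h1
    exact ⟨⟨W, hW⟩, fun a ha b hb => hWV (mk_mem_prod ha hb)⟩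
  choose g hg using hstep
  let ι := {U : ℕ → Set Y // (∀ n, U n ∈ 𝓝 y) ∧
    ∀ n, ∀ a ∈ U (n + 1), ∀ b ∈ U (n + 1), a ⊓ b ∈ U n}
  let F : ι → ℕ → Set X := fun U n => {x | (Φ x ∩ closure (U.1 n)).Nonempty}
  have hFc : ∀ U n, IsClosed (F U n) := fun U n => husc _ isClosed_closure
  have hUanti : ∀ U : ι, Antitone U.1 := fun U => antitone_nat_of_succ_le fun n a ha => by
    simpa using U.2.2 n a ha a ha
  obtain ⟨x, hx⟩ := exists_common hXk (fun U : ι => ⋂ n, F U n)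
    (fun U => isClosed_iInter (hFc U))
    (by
      intro U a ha b hb
      simp only [mem_iInter] at ha hb ⊢
      intro n
      obtain ⟨u, hu, hu'⟩ := ha (n + 1)
      obtain ⟨v, hv, hv'⟩ := hb (n + 1)
      exact ⟨u ⊓ v, hmul _ _ _ hu _ hv,
        map_mem_closure₂ hYcont hu' hv' (fun a ha b hb => U.2.2 n a ha b hb)⟩)
    (by
      intro U
      choose x v hv hvU using fun n => hyN (U.1 n) (U.2.1 n)
      have hk : ∀ k n, ∃ u ∈ Φ (finMeet x k (n + 1)), u ∈ U.1 n := by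
        intro k
        induction k with
        | zero => exact fun n => ⟨v (n + 1), hv _, hUanti U (Nat.le_succ n) (hvU _)⟩
        | succ k ih =>
          intro n
          obtain ⟨u, hu, hu'⟩ := ih (n + 1)
          exact ⟨v (n + 1) ⊓ u, hmul _ _ _ (hv _) _ hu, U.2.2 n _ (hvU _) _ hu'⟩
      obtain ⟨w, hw⟩ := exists_liminf hXk (F U) (hFc U)
        (fun m n hmn t ht => by
          obtain ⟨u, hu, hu'⟩ := ht
          exact ⟨u, hu, closure_mono (hUanti U hmn) hu'⟩) x
        (fun k n => by
          obtain ⟨u, hu, hu'⟩ := hk k n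
          exact ⟨u, hu, subset_closure hu'⟩)
      exact ⟨w, mem_iInter.2 hw⟩)
    (by
      intro U V
      refine ⟨⟨fun n => U.1 n ∩ V.1 n, fun n => Filter.inter_mem (U.2.1 n) (V.2.1 n),
        fun n a ha b hb => ⟨U.2.2 n a ha.1 b hb.1, V.2.2 n a ha.2 b hb.2⟩⟩, ?_⟩
      intro t ht
      rw [mem_iInter] at ht
      refine ⟨mem_iInter.2 fun n => ?_, mem_iInter.2 fun n => ?_⟩
      · obtain ⟨u, hu, hu'⟩ := ht n
        exact ⟨u, hu, closure_mono inter_subset_left hu'⟩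
      · obtain ⟨u, hu, hu'⟩ := ht n
        exact ⟨u, hu, closure_mono inter_subset_right hu'⟩)
  refine mem_iUnion.2 ⟨x, ?_⟩
  by_contra hyx
  obtain ⟨N, hN, hNc, hNd⟩ := hT2 x y hyx
  let U : ℕ → {V : Set Y // V ∈ 𝓝 y} := fun n => g^[n] ⟨N, hN⟩
  have hU : ∀ n, U (n + 1) = g (U n) := fun n => Function.iterate_succ_apply' g n _
  have h0 := mem_iInter.1 (hx ⟨fun n => (U n).1, fun n => (U n).2, fun n a ha b hb =>
    hg (U n) a (by rw [← hU]; exact ha) b (by rw [← hU]; exact hb)⟩) 0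
  obtain ⟨u, hu, hu'⟩ := h0
  have hu2 : u ∈ closure N := hu'
  rw [hNc.closure_eq] at hu2
  have : u ∈ N ∩ Φ x := ⟨hu2, hu⟩
  rw [hNd] at this
  exact this
end

section
/- Let X be a Hausdorff semitopological semilattice. Then X is chain-compact (every closed chain in X is compact) if and only if every maximal chain in X is compact. -/
open Set Topology

/-- A topologized semilattice `X` is *chain-compact* if every closed chain in `X`
is compact. -/
def ChainCompact (X : Type*) [SemilatticeInf X] [TopologicalSpace X] : Prop :=
  ∀ C : Set X, IsChain (· ≤ ·) C → IsClosed C → IsCompact C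

/-- A Hausdorff semitopological semilattice is chain-compact if and only if each of its
maximal chains is compact. -/
theorem stmt4 {X : Type*} [SemilatticeInf X] [TopologicalSpace X] [T2Space X]
    (hsep₁ : ∀ a : X, Continuous fun x : X => a ⊓ x)
    (hsep₂ : ∀ a : X, Continuous fun x : X => x ⊓ a) :
    ChainCompact X ↔ ∀ C : Set X, IsMaxChain (· ≤ ·) C → IsCompact C := by
  constructor
  · intro h C hC
    refine h C hC.isChain ?_
    refine isClosed_of_closure_subset fun x hx => ?_
    have key : ∀ c ∈ C, c ≤ x ∨ x ≤ c := by
      intro c hc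
      have hcl : IsClosed ({y : X | c ⊓ y = c} ∪ {y : X | c ⊓ y = y}) :=
        (isClosed_eq (hsep₁ c) continuous_const).union (isClosed_eq (hsep₁ c) continuous_id)
      have hsub : C ⊆ {y : X | c ⊓ y = c} ∪ {y : X | c ⊓ y = y} := by
        intro y hy
        rcases hC.isChain.total hc hy with h1 | h1
        · exact Or.inl (inf_eq_left.2 h1)
        · exact Or.inr (inf_eq_right.2 h1)
      rcases closure_minimal hsub hcl hx with h1 | h1
      · exact Or.inl (inf_eq_left.1 h1)
      · exact Or.inr (inf_eq_right.1 h1)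
    have hins : IsChain (· ≤ ·) (insert x C) :=
      hC.isChain.insert fun c hc _ => (key c hc).symm
    have heq : C = insert x C := hC.2 hins (subset_insert x C)
    rw [heq]
    exact mem_insert x C
  · intro h C hC hcl
    obtain ⟨M, hM, hCM⟩ := hC.exists_maxChain
    exact (h M hM).of_isClosed_subset hcl hCM
end

section
/- Let X be a Hausdorff semitopological semilattice. Then X is chain-compact (every closed chain in X is compact) if and only if X is k-complete, i.e., every nonempty chain C ⊆ X has a greatest lower bound inf C and a least upper bound sup C, both belonging to the closure of C in X. -/
open Set Topology

theorem stmt5 {X : Type*} [SemilatticeInf X] [TopologicalSpace X] [T2Space X]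
    (hsep₁ : ∀ a : X, Continuous fun x : X => a ⊓ x)
    (hsep₂ : ∀ a : X, Continuous fun x : X => x ⊓ a) :
    ChainCompact X ↔ KComplete X := by
  have hIic : ∀ a : X, IsClosed (Iic a) := by
    intro a
    have h : Iic a = {x | a ⊓ x = x} := by ext x; simp
    rw [h]; exact isClosed_eq (hsep₁ a) continuous_id
  have hIci : ∀ a : X, IsClosed (Ici a) := by
    intro a
    have h : Ici a = {x | a ⊓ x = a} := by ext x; simp
    rw [h]; exact isClosed_eq (hsep₁ a) continuous_const
  constructor
  · intro hX C hne hC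
    have h1 : ∀ c ∈ C, closure C ⊆ Iic c ∪ Ici c := fun c hc =>
      closure_minimal (fun x hx => hC.total hx hc) ((hIic c).union (hIci c))
    have h2 : ∀ x ∈ closure C, closure C ⊆ Iic x ∪ Ici x := fun x hx =>
      closure_minimal (fun c hc => (h1 c hc hx).symm) ((hIic x).union (hIci x))
    have hK : IsCompact (closure C) :=
      hX _ (fun x hx y hy _ => h2 y hy hx) isClosed_closure
    have : Nonempty C := hne.to_subtype
    constructor
    · have := IsCompact.nonempty_iInter_of_directed_nonempty_isCompact_isClosed
        (fun c : C => closure C ∩ Iic (c : X))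
        (by
          intro c d
          rcases hC.total c.2 d.2 with h | h
          · exact ⟨c, subset_rfl, inter_subset_inter_right _ (Iic_subset_Iic.2 h)⟩
          · exact ⟨d, inter_subset_inter_right _ (Iic_subset_Iic.2 h), subset_rfl⟩)
        (fun c => ⟨c, subset_closure c.2, le_rfl⟩)
        (fun c => hK.inter_right (hIic _))
        (fun c => isClosed_closure.inter (hIic _))
      obtain ⟨a, ha⟩ := this
      rw [mem_iInter] at ha
      have hm := (ha (Classical.arbitrary C)).1
      exact ⟨a, ⟨fun c hc => (ha ⟨c, hc⟩).2, fun b hb =>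
        closure_minimal (fun c hc => hb hc) (hIci b) hm⟩, hm⟩
    · have := IsCompact.nonempty_iInter_of_directed_nonempty_isCompact_isClosed
        (fun c : C => closure C ∩ Ici (c : X))
        (by
          intro c d
          rcases hC.total c.2 d.2 with h | h
          · exact ⟨d, inter_subset_inter_right _ (Ici_subset_Ici.2 h), subset_rfl⟩
          · exact ⟨c, subset_rfl, inter_subset_inter_right _ (Ici_subset_Ici.2 h)⟩)
        (fun c => ⟨c, subset_closure c.2, le_rfl⟩)
        (fun c => hK.inter_right (hIci _))
        (fun c => isClosed_closure.inter (hIci _))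
      obtain ⟨a, ha⟩ := this
      rw [mem_iInter] at ha
      have hm := (ha (Classical.arbitrary C)).1
      exact ⟨a, ⟨fun c hc => (ha ⟨c, hc⟩).2, fun b hb =>
        closure_minimal (fun c hc => hb hc) (hIic b) hm⟩, hm⟩
  · intro hX C hC hcl
    rw [isCompact_iff_ultrafilter_le_nhds]
    intro F hF
    have hCF : C ∈ F := Filter.le_principal_iff.1 hF
    have hmem : ∀ D ⊆ C, ∀ x ∈ closure D, x ∈ C := fun D hD x hx =>
      closure_minimal hD hcl hx
    let A : Set X := {x | x ∈ C ∧ Iic x ∈ F}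
    have hAC : A ⊆ C := fun x hx => hx.1
    have hAne : A.Nonempty := by
      obtain ⟨b, hb, hb'⟩ := (hX C (F.nonempty_of_mem hCF) hC).2
      exact ⟨b, hmem C subset_rfl b hb', Filter.mem_of_superset hCF fun x hx => hb.1 hx⟩
    obtain ⟨s, hs, hs'⟩ := (hX A hAne (hC.mono hAC)).1
    have hsC := hmem A hAC s hs'
    refine ⟨s, hsC, ?_⟩
    intro V hV
    obtain ⟨U, hUV, hU, hsU⟩ := mem_nhds_iff.1 hV
    refine Filter.mem_of_superset ?_ hUV
    by_contra hUF
    have hUF' : Uᶜ ∈ F := Ultrafilter.compl_mem_iff_notMem.2 hUF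
    by_cases hc : Iic s ∈ F
    · have hD : C ∩ Uᶜ ∩ Iic s ∈ F := Filter.inter_mem (Filter.inter_mem hCF hUF') hc
      have hDC : C ∩ Uᶜ ∩ Iic s ⊆ C := fun x hx => hx.1.1
      obtain ⟨t, ht, ht'⟩ := (hX _ (F.nonempty_of_mem hD) (hC.mono hDC)).2
      have hts : t ≤ s := ht.2 fun x hx => hx.2
      have hst : s ≤ t := hs.1 ⟨hmem _ hDC t ht', Filter.mem_of_superset hD fun x hx => ht.1 hx⟩
      obtain rfl := le_antisymm hts hst
      exact closure_minimal (fun x hx => hx.1.2) hU.isClosed_compl ht' hsU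
    · have hc' : (Iic s)ᶜ ∈ F := Ultrafilter.compl_mem_iff_notMem.2 hc
      have hD : C ∩ Uᶜ ∩ (Iic s)ᶜ ∈ F := Filter.inter_mem (Filter.inter_mem hCF hUF') hc'
      have hDC : C ∩ Uᶜ ∩ (Iic s)ᶜ ⊆ C := fun x hx => hx.1.1
      obtain ⟨t, ht, ht'⟩ := (hX _ (F.nonempty_of_mem hD) (hC.mono hDC)).1
      have hst : s ≤ t := ht.2 fun x hx => (hC.total hx.1.1 hsC).resolve_left hx.2
      have hts : t ≤ s := hs.2 fun a ha => by
        obtain ⟨d, hd, hda⟩ := F.nonempty_of_mem (Filter.inter_mem hD ha.2)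
        exact (ht.1 hd).trans hda
      obtain rfl := le_antisymm hts hst
      exact closure_minimal (fun x hx => hx.1.2) hU.isClosed_compl ht' hsU
end

section
/- Let X be a Hausdorff semitopological semilattice. Then X is chain-compact (every closed chain in X is compact) if and only if for every closed subsemilattice Z ⊆ X and every continuous semilattice homomorphism h : Z → Y into a Hausdorff topological semilattice Y, the image h(Z) is closed in Y. -/
open Set Topology

universe u

section Aux

variable {X : Type u} [SemilatticeInf X] [TopologicalSpace X] [T2Space X]

/-- Nonempty closed subsemilattices. -/
def CSub (P : Set X) : Prop := IsClosed P ∧ P.Nonempty ∧ ∀ a ∈ P, ∀ b ∈ P, a ⊓ b ∈ P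

theorem aux_Ici (hsep₁ : ∀ a : X, Continuous fun x : X => a ⊓ x) (a : X) :
    IsClosed {x : X | a ≤ x} := by
  have : {x : X | a ≤ x} = {x | a ⊓ x = a} := by ext x; simp
  rw [this]
  exact isClosed_eq (hsep₁ a) continuous_const

theorem aux_Iic (hsep₁ : ∀ a : X, Continuous fun x : X => a ⊓ x) (a : X) :
    IsClosed {x : X | x ≤ a} := by
  have : {x : X | x ≤ a} = {x | a ⊓ x = x} := by ext x; simp
  rw [this]
  exact isClosed_eq (hsep₁ a) continuous_id

theorem aux_chain (hsep₁ : ∀ a : X, Continuous fun x : X => a ⊓ x) {A : Set X}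
    (hA : IsChain (· ≤ ·) A) : IsChain (· ≤ ·) (closure A) := by
  have cl : ∀ a : X, IsClosed {x : X | a ≤ x ∨ x ≤ a} := fun a =>
    (aux_Ici hsep₁ a).union (aux_Iic hsep₁ a)
  have h1 : ∀ a ∈ A, ∀ x ∈ closure A, a ≤ x ∨ x ≤ a := by
    intro a ha x hx
    exact closure_minimal (fun b hb => hA.total ha hb) (cl a) hx
  intro x hx y hy _
  exact closure_minimal (fun b hb => (h1 b hb x hx).symm) (cl x) hy

theorem aux_semi (hsep₁ : ∀ a : X, Continuous fun x : X => a ⊓ x) {S : Set X}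
    (hS : ∀ a ∈ S, ∀ b ∈ S, a ⊓ b ∈ S) :
    ∀ a ∈ closure S, ∀ b ∈ closure S, a ⊓ b ∈ closure S := by
  have h1 : ∀ a ∈ S, ∀ b ∈ closure S, a ⊓ b ∈ closure S := fun a ha b hb =>
    map_mem_closure (hsep₁ a) hb (fun c hc => hS a ha c hc)
  intro a ha b hb
  have : b ⊓ a ∈ closure (closure S) :=
    map_mem_closure (hsep₁ b) ha (fun c hc => by rw [inf_comm]; exact h1 c hc b hb)
  rwa [closure_closure, inf_comm] at this

theorem aux_min (hsep₁ : ∀ a : X, Continuous fun x : X => a ⊓ x) (hc : ChainCompact X)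
    {P : Set X} (hP : CSub P) : ∃ m ∈ P, ∀ x ∈ P, m ≤ x := by
  obtain ⟨hcl, ⟨p, hp⟩, hinf⟩ := hP
  obtain ⟨m, -, hm⟩ := zorn_le_nonempty₀ (α := Xᵒᵈ) (OrderDual.ofDual ⁻¹' P) (by
    intro c hcP hch y hy
    let A : Set X := OrderDual.toDual ⁻¹' c
    have hA : IsChain (· ≤ ·) A := by
      intro a ha b hb hab
      exact (hch ha hb hab).symm
    have hAP : A ⊆ P := hcP
    have hcomp := hc _ (aux_chain hsep₁ hA) isClosed_closure
    have : Nonempty A := ⟨⟨_, hy⟩⟩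
    obtain ⟨w, hw⟩ := IsCompact.nonempty_iInter_of_directed_nonempty_isCompact_isClosed
      (fun a : A => closure A ∩ {x | x ≤ a.1})
      (by
        intro a b
        rcases hA.total a.2 b.2 with h | h
        · exact ⟨a, subset_rfl, fun x hx => ⟨hx.1, le_trans hx.2 h⟩⟩
        · exact ⟨b, fun x hx => ⟨hx.1, le_trans hx.2 h⟩, subset_rfl⟩)
      (fun a => ⟨a, subset_closure a.2, le_refl a.1⟩)
      (fun a => hcomp.inter_right (aux_Iic hsep₁ _))
      (fun a => isClosed_closure.inter (aux_Iic hsep₁ _))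
    rw [mem_iInter] at hw
    exact ⟨OrderDual.toDual w, closure_minimal hAP hcl (hw ⟨_, hy⟩).1, fun z hz => (hw ⟨_, hz⟩).2⟩)
    (OrderDual.toDual p) hp
  refine ⟨OrderDual.ofDual m, hm.1, fun x hx => ?_⟩
  have := hm.2 (y := OrderDual.toDual (OrderDual.ofDual m ⊓ x)) (hinf _ hm.1 _ hx)
    (inf_le_left : OrderDual.ofDual m ⊓ x ≤ OrderDual.ofDual m)
  exact le_trans (show OrderDual.ofDual m ≤ OrderDual.ofDual m ⊓ x from this) inf_le_right

theorem aux_chainInter (hsep₁ : ∀ a : X, Continuous fun x : X => a ⊓ x) (hc : ChainCompact X)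
    {C : Set (Set X)} (hC : ∀ P ∈ C, CSub P) (hch : IsChain (· ⊆ ·) C) (hne : C.Nonempty) :
    (⋂₀ C).Nonempty := by
  have hm : ∀ P : C, ∃ m ∈ P.1, ∀ x ∈ P.1, m ≤ x := fun P => aux_min hsep₁ hc (hC _ P.2)
  choose m hmP hmin using hm
  have hA : IsChain (· ≤ ·) (range m) := by
    rintro _ ⟨P, rfl⟩ _ ⟨Q, rfl⟩ _
    rcases hch.total P.2 Q.2 with h | h
    · exact Or.inr (hmin Q _ (h (hmP P)))
    · exact Or.inl (hmin P _ (h (hmP Q)))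
  have hcomp := hc _ (aux_chain hsep₁ hA) isClosed_closure
  have : Nonempty C := hne.to_subtype
  obtain ⟨w, hw⟩ := IsCompact.nonempty_iInter_of_directed_nonempty_isCompact_isClosed
      (fun P : C => closure (range m) ∩ P.1)
      (by
        intro a b
        rcases hch.total a.2 b.2 with h | h
        · exact ⟨a, subset_rfl, fun x hx => ⟨hx.1, h hx.2⟩⟩
        · exact ⟨b, fun x hx => ⟨hx.1, h hx.2⟩, subset_rfl⟩)
      (fun a => ⟨m a, subset_closure ⟨a, rfl⟩, hmP a⟩)
      (fun a => hcomp.inter_right (hC _ a.2).1)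
      (fun a => isClosed_closure.inter (hC _ a.2).1)
  rw [mem_iInter] at hw
  exact ⟨w, fun P hP => (hw ⟨P, hP⟩).2⟩

/-- Directed families of nonempty closed subsemilattices. -/
def DFam (F : Set (Set X)) : Prop :=
  (∀ P ∈ F, CSub P) ∧ ∀ P ∈ F, ∀ Q ∈ F, ∃ R ∈ F, R ⊆ P ∩ Q

theorem aux_directed_s7 (hsep₁ : ∀ a : X, Continuous fun x : X => a ⊓ x) (hc : ChainCompact X)
    {F : Set (Set X)} (hF : DFam F) (hne : F.Nonempty) : (⋂₀ F).Nonempty := by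
  obtain ⟨M, hFM, hM⟩ := zorn_subset_nonempty {G : Set (Set X) | DFam G} (by
    intro c hcS hch hcne
    refine ⟨⋃₀ c, ⟨?_, ?_⟩, fun s hs => subset_sUnion_of_mem hs⟩
    · rintro P ⟨G, hG, hP⟩
      exact (hcS hG).1 P hP
    · rintro P ⟨G, hG, hP⟩ Q ⟨H, hH, hQ⟩
      rcases hch.total hG hH with h | h
      · obtain ⟨R, hR, hR'⟩ := (hcS hH).2 P (h hP) Q hQ
        exact ⟨R, ⟨H, hH, hR⟩, hR'⟩
      · obtain ⟨R, hR, hR'⟩ := (hcS hG).2 P hP Q (h hQ)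
        exact ⟨R, ⟨G, hG, hR⟩, hR'⟩) F hF
  obtain ⟨hMd : DFam M, hMmax⟩ := hM
  obtain ⟨F0, hF0⟩ := hne
  obtain ⟨K, -, hK⟩ := zorn_superset_nonempty M (by
    intro c hcM hch hcne
    obtain ⟨P0, hP0⟩ := hcne
    have key : ∀ Q ∈ M, CSub (⋂₀ c ∩ Q) := by
      intro Q hQ
      refine ⟨(isClosed_sInter fun P hP => (hMd.1 P (hcM hP)).1).inter (hMd.1 Q hQ).1, ?_, ?_⟩
      · have := aux_chainInter hsep₁ hc (C := (fun P => P ∩ Q) '' c) (by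
          rintro _ ⟨P, hP, rfl⟩
          have h1 := hMd.1 P (hcM hP)
          have h2 := hMd.1 Q hQ
          refine ⟨h1.1.inter h2.1, ?_, fun a ha b hb =>
            ⟨h1.2.2 a ha.1 b hb.1, h2.2.2 a ha.2 b hb.2⟩⟩
          obtain ⟨R, hR, hR'⟩ := hMd.2 P (hcM hP) Q hQ
          exact (hMd.1 R hR).2.1.mono hR')
          (by
            rintro _ ⟨P, hP, rfl⟩ _ ⟨P', hP', rfl⟩ _
            rcases hch.total hP hP' with h | h
            · exact Or.inl (inter_subset_inter_left _ h)
            · exact Or.inr (inter_subset_inter_left _ h)) ⟨_, P0, hP0, rfl⟩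
        obtain ⟨w, hw⟩ := this
        exact ⟨w, fun P hP => (hw _ ⟨P, hP, rfl⟩).1, (hw _ ⟨P0, hP0, rfl⟩).2⟩
      · intro a ha b hb
        exact ⟨fun P hP => (hMd.1 P (hcM hP)).2.2 a (ha.1 P hP) b (hb.1 P hP),
          (hMd.1 Q hQ).2.2 a ha.2 b hb.2⟩
    let M' : Set (Set X) := M ∪ (fun Q => ⋂₀ c ∩ Q) '' M
    have hM' : DFam M' := by
      refine ⟨?_, ?_⟩
      · rintro P (hP | ⟨Q, hQ, rfl⟩)
        · exact hMd.1 P hP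
        · exact key Q hQ
      · have hh : ∀ P ∈ M', ∃ Q ∈ M, ⋂₀ c ∩ Q ⊆ P := by
          rintro P (hP | ⟨Q, hQ, rfl⟩)
          · exact ⟨P, hP, inter_subset_right⟩
          · exact ⟨Q, hQ, subset_rfl⟩
        intro P hP Q hQ
        obtain ⟨P1, hP1, h1⟩ := hh P hP
        obtain ⟨Q1, hQ1, h2⟩ := hh Q hQ
        obtain ⟨R, hR, hR'⟩ := hMd.2 P1 hP1 Q1 hQ1
        exact ⟨_, Or.inr ⟨R, hR, rfl⟩, fun x hx =>
          ⟨h1 ⟨hx.1, (hR' hx.2).1⟩, h2 ⟨hx.1, (hR' hx.2).2⟩⟩⟩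
    have := hMmax hM' (show M ≤ M' from subset_union_left)
    exact ⟨⋂₀ c ∩ P0, this (Or.inr ⟨P0, hcM hP0, rfl⟩), fun s hs x hx => hx.1 s hs⟩) F0 (hFM hF0)
  obtain ⟨w, hw⟩ := (hMd.1 K hK.1).2.1
  refine ⟨w, fun P hP => ?_⟩
  obtain ⟨R, hR, hR'⟩ := hMd.2 K hK.1 P (hFM hP)
  exact (hR' (hK.2 hR (fun x hx => (hR' hx).1) hw)).2

/-- Sequences of neighbourhoods. -/
def NSeq {Y : Type u} [SemilatticeInf Y] [TopologicalSpace Y] (y : Y) (U : ℕ → Set Y) : Prop :=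
  (∀ n, U n ∈ 𝓝 y) ∧ ∀ n, ∀ a ∈ U (n+1), ∀ b ∈ U (n+1), a ⊓ b ∈ U n

theorem aux_forward (hsep₁ : ∀ a : X, Continuous fun x : X => a ⊓ x) (hc : ChainCompact X)
    (Z : Set X) (hZ : IsClosed Z) (hZi : ∀ a ∈ Z, ∀ b ∈ Z, a ⊓ b ∈ Z)
    (Y : Type u) [SemilatticeInf Y] [TopologicalSpace Y] [T2Space Y]
    (hY : Continuous fun p : Y × Y => p.1 ⊓ p.2) (h : X → Y) (hh : ContinuousOn h Z)
    (hom : ∀ a ∈ Z, ∀ b ∈ Z, h (a ⊓ b) = h a ⊓ h b) : IsClosed (h '' Z) := by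
  rw [← closure_subset_iff_isClosed]
  intro y hy
  have hstep : ∀ V ∈ 𝓝 y, ∃ W ∈ 𝓝 y, ∀ a ∈ W, ∀ b ∈ W, a ⊓ b ∈ V := by
    intro V hV
    have h1 : (fun p : Y × Y => p.1 ⊓ p.2) ⁻¹' V ∈ 𝓝 (y, y) :=
      hY.continuousAt.preimage_mem_nhds (by simpa using hV)
    rw [nhds_prod_eq, Filter.mem_prod_same_iff] at h1
    obtain ⟨W, hW, hW'⟩ := h1
    exact ⟨W, hW, fun a ha b hb => hW' (mk_mem_prod ha hb)⟩
  have hseq : ∀ V ∈ 𝓝 y, ∃ U, NSeq y U ∧ U 0 = V := by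
    intro V hV
    choose! f hf1 hf2 using hstep
    have hn : ∀ n, f^[n] V ∈ 𝓝 y := by
      intro n
      induction n with
      | zero => exact hV
      | succ n ih => rw [Function.iterate_succ_apply']; exact hf1 _ ih
    refine ⟨fun n => f^[n] V, ⟨hn, fun n a ha b hb => ?_⟩, rfl⟩
    simp only [Function.iterate_succ_apply'] at ha hb
    exact hf2 _ (hn n) a ha b hb
  let T : (ℕ → Set Y) → Set X := fun U => {z ∈ Z | ∀ n, h z ∈ closure (U n)}
  have hTcl : ∀ U, IsClosed (T U) := by
    intro U
    have : T U = Z ∩ h ⁻¹' (⋂ n, closure (U n)) := by ext; simp [T]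
    rw [this]
    exact hh.preimage_isClosed_of_isClosed hZ (isClosed_iInter fun n => isClosed_closure)
  have hTinf : ∀ U, NSeq y U → ∀ a ∈ T U, ∀ b ∈ T U, a ⊓ b ∈ T U := by
    intro U hU a ha b hb
    refine ⟨hZi a ha.1 b hb.1, fun n => ?_⟩
    rw [hom a ha.1 b hb.1]
    exact map_mem_closure₂ (f := fun p q : Y => p ⊓ q) hY (ha.2 (n+1)) (hb.2 (n+1))
      (fun a ha b hb => hU.2 n a ha b hb)
  have hTne : ∀ U, NSeq y U → (T U).Nonempty := by
    intro U hU
    have hanti : Antitone U := antitone_nat_of_succ_le fun n a ha => by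
      simpa using hU.2 n a ha a ha
    have hz : ∀ n, ∃ z ∈ Z, h z ∈ U n := by
      intro n
      obtain ⟨_, h1, z, hz, rfl⟩ := mem_closure_iff_nhds.1 hy _ (hU.1 n)
      exact ⟨z, hz, h1⟩
    choose z hzZ hzU using hz
    have hfin : ∀ s : Finset ℕ, ∀ hs : s.Nonempty, s.inf' hs z ∈ Z ∧
        ∀ k, (∀ i ∈ s, k < i) → h (s.inf' hs z) ∈ U k := by
      intro s
      induction s using Finset.induction_on_min with
      | empty => intro hs; exact absurd hs (by simp)
      | insert a s has ih =>
        intro hs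
        rcases s.eq_empty_or_nonempty with rfl | hs'
        · simp only [insert_empty_eq, Finset.inf'_singleton]
          exact ⟨hzZ a, fun k hk => hanti (hk a (by simp)).le (hzU a)⟩
        · rw [Finset.inf'_insert (H := hs')]
          obtain ⟨i1, i2⟩ := ih hs'
          refine ⟨hZi _ (hzZ a) _ i1, fun k hk => ?_⟩
          rw [hom _ (hzZ a) _ i1]
          have ka : k + 1 ≤ a := hk a (by simp)
          exact hU.2 k _ (hanti ka (hzU a)) _ (hanti ka (i2 a has))
    let S : ℕ → Set X := fun k =>
      {x | ∃ s : Finset ℕ, ∃ hs : s.Nonempty, (∀ i ∈ s, k < i) ∧ x = s.inf' hs z}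
    have hSanti : ∀ j k, j ≤ k → S k ⊆ S j := by
      rintro j k hjk x ⟨s, hs, h1, h2⟩
      exact ⟨s, hs, fun i hi => hjk.trans_lt (h1 i hi), h2⟩
    have hSZ : ∀ k, S k ⊆ Z := by
      rintro k x ⟨s, hs, h1, rfl⟩
      exact (hfin s hs).1
    obtain ⟨w, hw⟩ := aux_directed_s7 hsep₁ hc (F := range fun k => closure (S k)) (by
      constructor
      · rintro _ ⟨k, rfl⟩
        refine ⟨isClosed_closure, ⟨z (k+1), subset_closure ⟨{k+1}, by simp, by simp, by simp⟩⟩,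
          aux_semi hsep₁ ?_⟩
        rintro _ ⟨s, hs, h1, rfl⟩ _ ⟨t, ht, h2, rfl⟩
        refine ⟨s ∪ t, hs.mono Finset.subset_union_left, ?_, (Finset.inf'_union hs ht z).symm⟩
        intro i hi
        rcases Finset.mem_union.1 hi with hi | hi
        · exact h1 i hi
        · exact h2 i hi
      · rintro _ ⟨j, rfl⟩ _ ⟨k, rfl⟩
        exact ⟨_, ⟨max j k, rfl⟩, subset_inter (closure_mono (hSanti _ _ (le_max_left _ _)))
          (closure_mono (hSanti _ _ (le_max_right _ _)))⟩) ⟨_, 0, rfl⟩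
    have hwk : ∀ k, w ∈ closure (S k) := fun k => hw _ ⟨k, rfl⟩
    have hwZ : w ∈ Z := closure_minimal (hSZ 0) hZ (hwk 0)
    refine ⟨w, hwZ, fun k => ?_⟩
    have hcl : IsClosed (Z ∩ h ⁻¹' closure (U k)) :=
      hh.preimage_isClosed_of_isClosed hZ isClosed_closure
    refine (closure_minimal ?_ hcl (hwk k)).2
    rintro x ⟨s, hs, h1, rfl⟩
    exact ⟨(hfin s hs).1, subset_closure ((hfin s hs).2 k h1)⟩
  obtain ⟨w, hw⟩ := aux_directed_s7 hsep₁ hc (F := T '' {U | NSeq y U}) (by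
    constructor
    · rintro _ ⟨U, hU, rfl⟩
      exact ⟨hTcl U, hTne U hU, hTinf U hU⟩
    · rintro _ ⟨U, hU, rfl⟩ _ ⟨V, hV, rfl⟩
      refine ⟨_, ⟨fun n => U n ∩ V n, ⟨fun n => Filter.inter_mem (hU.1 n) (hV.1 n),
        fun n a ha b hb => ⟨hU.2 n a ha.1 b hb.1, hV.2 n a ha.2 b hb.2⟩⟩, rfl⟩, ?_⟩
      intro x hx
      exact ⟨⟨hx.1, fun n => closure_mono inter_subset_left (hx.2 n)⟩,
        ⟨hx.1, fun n => closure_mono inter_subset_right (hx.2 n)⟩⟩)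
    (by
      obtain ⟨U, hU, -⟩ := hseq univ Filter.univ_mem
      exact ⟨_, U, hU, rfl⟩)
  have hwV : ∀ V ∈ 𝓝 y, w ∈ Z ∧ h w ∈ closure V := by
    intro V hV
    obtain ⟨U, hU, rfl⟩ := hseq V hV
    have := hw _ ⟨U, hU, rfl⟩
    exact ⟨this.1, this.2 0⟩
  refine ⟨w, (hwV univ Filter.univ_mem).1, ?_⟩
  by_contra hne
  obtain ⟨A, B, hA, hB, h1, h2, hd⟩ := t2_separation hne
  have := (hwV B (hB.mem_nhds h2)).2
  obtain ⟨v, hv1, hv2⟩ := mem_closure_iff.1 this A hA h1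
  exact hd.le_bot ⟨hv1, hv2⟩

theorem aux_backward (hsep₁ : ∀ a : X, Continuous fun x : X => a ⊓ x)
    (H : ∀ Z : Set X, IsClosed Z → (∀ a ∈ Z, ∀ b ∈ Z, a ⊓ b ∈ Z) →
        ∀ (Y : Type u) [SemilatticeInf Y] [TopologicalSpace Y] [T2Space Y],
          (Continuous fun p : Y × Y => p.1 ⊓ p.2) →
          ∀ h : X → Y, ContinuousOn h Z →
            (∀ a ∈ Z, ∀ b ∈ Z, h (a ⊓ b) = h a ⊓ h b) →
            IsClosed (h '' Z)) : ChainCompact X := by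
  classical
  intro C hC hCcl
  rw [isCompact_iff_ultrafilter_le_nhds]
  intro F hFC
  by_contra! hno
  have hCF : C ∈ F := Filter.le_principal_iff.1 hFC
  let L : Set X := {c ∈ C | {x | c ≤ x} ∈ F}
  let U : Set X := {c ∈ C | {x | x ≤ c} ∈ F}
  have hnhd : ∀ c ∈ C, ∃ V, IsOpen V ∧ c ∈ V ∧ V ∉ F := by
    intro c hc
    by_contra! hcon
    refine hno c hc ?_
    intro s hs
    obtain ⟨V, hV, hVo, hcV⟩ := mem_nhds_iff.1 hs
    exact Filter.mem_of_superset (hcon V hVo hcV) hV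
  have hnot : ∀ c, c ∈ L → c ∈ U → False := by
    intro c h1 h2
    obtain ⟨V, -, hcV, hV⟩ := hnhd c h1.1
    refine hV (Filter.mem_of_superset (Filter.inter_mem h1.2 h2.2) ?_)
    rintro x ⟨hx1, hx2⟩
    rwa [← le_antisymm hx1 hx2]
  have hLU : ∀ c ∈ C, c ∈ L ∨ c ∈ U := by
    intro c hc
    have : {x | c ≤ x} ∪ {x | x ≤ c} ∈ F :=
      Filter.mem_of_superset hCF fun x hx => hC.total hc hx
    rcases Ultrafilter.union_mem_iff.1 this with h | h
    · exact Or.inl ⟨hc, h⟩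
    · exact Or.inr ⟨hc, h⟩
  have hltLU : ∀ a ∈ L, ∀ b ∈ U, a < b := by
    intro a ha b hb
    rcases hC.total ha.1 hb.1 with h | h
    · exact lt_of_le_of_ne h (fun e => hnot a ha (e ▸ hb))
    · exact (hnot a ha ⟨ha.1, Filter.mem_of_superset hb.2 fun x hx => le_trans hx h⟩).elim
  have hZ1 : ∃ V, IsOpen V ∧ V ∉ F ∧ ∀ c ∈ L, (∀ x ∈ L, x ≤ c) → c ∈ V := by
    by_cases he : ∃ c ∈ L, ∀ x ∈ L, x ≤ c
    · obtain ⟨c, hc, hm⟩ := he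
      obtain ⟨V, h1, h2, h3⟩ := hnhd c hc.1
      exact ⟨V, h1, h3, fun d hd hd' => le_antisymm (hd' c hc) (hm d hd) ▸ h2⟩
    · exact ⟨∅, isOpen_empty, F.empty_notMem, fun c hc hm => (he ⟨c, hc, hm⟩).elim⟩
  have hZ2 : ∃ V, IsOpen V ∧ V ∉ F ∧ ∀ c ∈ U, (∀ x ∈ U, c ≤ x) → c ∈ V := by
    by_cases he : ∃ c ∈ U, ∀ x ∈ U, c ≤ x
    · obtain ⟨c, hc, hm⟩ := he
      obtain ⟨V, h1, h2, h3⟩ := hnhd c hc.1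
      exact ⟨V, h1, h3, fun d hd hd' => le_antisymm (hm d hd) (hd' c hc) ▸ h2⟩
    · exact ⟨∅, isOpen_empty, F.empty_notMem, fun c hc hm => (he ⟨c, hc, hm⟩).elim⟩
  obtain ⟨V1, hV1o, hV1F, hV1⟩ := hZ1
  obtain ⟨V2, hV2o, hV2F, hV2⟩ := hZ2
  let Z : Set X := C ∩ (V1ᶜ ∩ V2ᶜ)
  have hZcl : IsClosed Z := hCcl.inter (hV1o.isClosed_compl.inter hV2o.isClosed_compl)
  have hZF : Z ∈ F := Filter.inter_mem hCF (Filter.inter_mem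
    (Ultrafilter.compl_mem_iff_notMem.2 hV1F) (Ultrafilter.compl_mem_iff_notMem.2 hV2F))
  have hZC : Z ⊆ C := fun x hx => hx.1
  have hZL : ∀ x ∈ Z, x ∈ L → ∃ y ∈ L, x < y := by
    intro x hx hxL
    by_contra! hcon
    refine hx.2.1 (hV1 x hxL fun y hy => ?_)
    rcases hC.total hxL.1 hy.1 with h | h
    · rcases h.eq_or_lt with e | e
      · exact e.ge
      · exact (hcon y hy e).elim
    · exact h
  have hZU : ∀ x ∈ Z, x ∈ U → ∃ y ∈ U, y < x := by
    intro x hx hxU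
    by_contra! hcon
    refine hx.2.2 (hV2 x hxU fun y hy => ?_)
    rcases hC.total hxU.1 hy.1 with h | h
    · exact h
    · rcases h.eq_or_lt with e | e
      · exact e.ge
      · exact (hcon y hy e).elim
  -- the target: a linearly ordered set of subsets of `C`
  let g : X → Set X := fun x => {w ∈ C | w ≤ x}
  have gmono : ∀ x y, x ≤ y → g x ⊆ g y := fun x y hxy w hw => ⟨hw.1, hw.2.trans hxy⟩
  have gle : ∀ x ∈ C, ∀ y, g x ⊆ g y → x ≤ y := fun x hx y h => (h ⟨hx, le_refl x⟩).2
  let Y : Type u := {s : Set X // s = L ∨ ∃ z ∈ Z, s = g z}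
  have hgL : ∀ x ∈ L, g x ⊆ L := by
    intro x hx w hw
    exact ⟨hw.1, Filter.mem_of_superset hx.2 fun t ht => le_trans hw.2 ht⟩
  have hgU : ∀ x ∈ U, L ⊆ g x := fun x hx w hw => ⟨hw.1, (hltLU w hw x hx).le⟩
  have htot : ∀ a b : Y, a ≤ b ∨ b ≤ a := by
    have h1 : ∀ z ∈ Z, g z ⊆ L ∨ L ⊆ g z := fun z hz =>
      (hLU z hz.1).imp (hgL z) (hgU z)
    rintro ⟨a, rfl | ⟨z, hz, rfl⟩⟩ ⟨b, rfl | ⟨w, hw, rfl⟩⟩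
    · exact Or.inl (le_refl _)
    · exact (h1 w hw).symm
    · exact h1 z hz
    · exact (hC.total hz.1 hw.1).imp (gmono _ _) (gmono _ _)
  letI : LinearOrder Y :=
    { (inferInstance : PartialOrder Y) with
      le_total := htot
      toDecidableLE := Classical.decRel _ }
  letI : TopologicalSpace Y := Preorder.topology Y
  haveI : OrderTopology Y := ⟨rfl⟩
  let p : Y := ⟨L, Or.inl rfl⟩
  let h : X → Y := fun x => if hx : x ∈ Z then ⟨g x, Or.inr ⟨x, hx, rfl⟩⟩ else p
  have hval : ∀ x ∈ Z, (h x).1 = g x := fun x hx => by simp [h, hx]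
  have hle : ∀ x ∈ Z, ∀ y ∈ Z, (h x ≤ h y ↔ x ≤ y) := by
    intro x hx y hy
    have : h x ≤ h y ↔ g x ⊆ g y := by
      rw [← hval x hx, ← hval y hy]; exact Iff.rfl
    rw [this]
    exact ⟨gle x hx.1 y, gmono x y⟩
  have hltL : ∀ x ∈ Z, (h x < p ↔ x ∈ L) := by
    intro x hx
    constructor
    · intro hlt
      rcases hLU x hx.1 with h1 | h1
      · exact h1
      · refine (not_le_of_gt hlt ?_).elim
        change L ⊆ (h x).1
        rw [hval x hx]; exact hgU x h1
    · intro hxL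
      rw [← not_le]
      intro hcon
      change L ⊆ (h x).1 at hcon
      rw [hval x hx] at hcon
      obtain ⟨y, hy, hxy⟩ := hZL x hx hxL
      exact not_le_of_gt hxy (hcon hy).2
  have hltU : ∀ x ∈ Z, (p < h x ↔ x ∈ U) := by
    intro x hx
    constructor
    · intro hlt
      rcases hLU x hx.1 with h1 | h1
      · exact (lt_asymm hlt ((hltL x hx).2 h1)).elim
      · exact h1
    · intro hxU
      rw [← not_le]
      intro hcon
      change (h x).1 ⊆ L at hcon
      rw [hval x hx] at hcon
      exact hnot x (hcon ⟨hx.1, le_refl x⟩) hxU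
  have hcases : ∀ a : Y, a = p ∨ ∃ z ∈ Z, a = h z := by
    rintro ⟨a, ha⟩
    rcases ha with rfl | ⟨z, hz, rfl⟩
    · exact Or.inl rfl
    · exact Or.inr ⟨z, hz, Subtype.ext (hval z hz).symm⟩
  -- open rays
  have hoIio : ∀ y x : X, ¬ y ≤ x → {t | ¬ y ≤ t} ∈ 𝓝 x := fun y x hyx =>
    (aux_Ici hsep₁ y).isOpen_compl.mem_nhds hyx
  have hoIoi : ∀ y x : X, ¬ x ≤ y → {t | ¬ t ≤ y} ∈ 𝓝 x := fun y x hyx =>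
    (aux_Iic hsep₁ y).isOpen_compl.mem_nhds hyx
  have hcont : ContinuousOn h Z := by
    intro x hx
    change Filter.Tendsto h (𝓝[Z] x) (𝓝 (h x))
    rw [tendsto_order]
    constructor
    · intro a ha
      rcases hcases a with rfl | ⟨z, hz, rfl⟩
      · obtain ⟨y, hyU, hyx⟩ := hZU x hx ((hltU x hx).1 ha)
        filter_upwards [self_mem_nhdsWithin, mem_nhdsWithin_of_mem_nhds
          (hoIoi y x (not_le_of_gt hyx))] with t ht hty
        rw [hltU t ht]
        refine (hLU t ht.1).resolve_left fun htL => hty ?_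
        exact (hltLU t htL y hyU).le
      · rw [← not_le, hle x hx z hz] at ha
        filter_upwards [self_mem_nhdsWithin, mem_nhdsWithin_of_mem_nhds
          (hoIoi z x ha)] with t ht hty
        rw [← not_le, hle t ht z hz]
        exact hty
    · intro a ha
      rcases hcases a with rfl | ⟨z, hz, rfl⟩
      · obtain ⟨y, hyL, hyx⟩ := hZL x hx ((hltL x hx).1 ha)
        filter_upwards [self_mem_nhdsWithin, mem_nhdsWithin_of_mem_nhds
          (hoIio y x (not_le_of_gt hyx))] with t ht hty
        rw [hltL t ht]
        refine (hLU t ht.1).resolve_right fun htU => hty ?_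
        exact (hltLU y hyL t htU).le
      · rw [gt_iff_lt, ← not_le, hle z hz x hx] at ha
        filter_upwards [self_mem_nhdsWithin, mem_nhdsWithin_of_mem_nhds
          (hoIio z x ha)] with t ht hty
        rw [← not_le, hle z hz t ht]
        exact hty
  have hZinf : ∀ a ∈ Z, ∀ b ∈ Z, a ⊓ b ∈ Z := by
    intro a ha b hb
    rcases hC.total ha.1 hb.1 with e | e
    · rwa [inf_eq_left.2 e]
    · rwa [inf_eq_right.2 e]
  have hhom : ∀ a ∈ Z, ∀ b ∈ Z, h (a ⊓ b) = h a ⊓ h b := by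
    intro a ha b hb
    rcases hC.total ha.1 hb.1 with e | e
    · rw [inf_eq_left.2 e, inf_eq_left.2 ((hle a ha b hb).2 e)]
    · rw [inf_eq_right.2 e, inf_eq_right.2 ((hle b hb a ha).2 e)]
  have hclosed := H Z hZcl hZinf Y (continuous_fst.inf continuous_snd) h hcont hhom
  have htend : Filter.Tendsto h F (𝓝 p) := by
    rw [tendsto_order]
    constructor
    · intro a ha
      rcases hcases a with rfl | ⟨z, hz, rfl⟩
      · exact (lt_irrefl _ ha).elim
      · obtain ⟨y, hyL, hzy⟩ := hZL z hz ((hltL z hz).1 ha)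
        filter_upwards [hZF, hyL.2] with t ht hyt
        rw [← not_le, hle t ht z hz]
        exact not_le_of_gt (lt_of_lt_of_le hzy hyt)
    · intro a ha
      rcases hcases a with rfl | ⟨z, hz, rfl⟩
      · exact (lt_irrefl _ ha).elim
      · obtain ⟨y, hyU, hzy⟩ := hZU z hz ((hltU z hz).1 ha)
        filter_upwards [hZF, hyU.2] with t ht hyt
        rw [← not_le, hle z hz t ht]
        exact not_le_of_gt (lt_of_le_of_lt hyt hzy)
  have hp : p ∈ h '' Z := hclosed.mem_of_tendsto htend
    (Filter.mem_of_superset hZF fun x hx => ⟨x, hx, rfl⟩)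
  obtain ⟨x, hx, hxp⟩ := hp
  rcases hLU x hx.1 with h1 | h1
  · exact ((hltL x hx).2 h1).ne hxp
  · exact ((hltU x hx).2 h1).ne hxp.symm

end Aux

/-- A Hausdorff semitopological semilattice `X` is chain-compact if and only if for every
closed subsemilattice `Z ⊆ X` and every continuous semilattice homomorphism `h : Z → Y`
into a Hausdorff topological semilattice `Y`, the image `h(Z)` is closed in `Y`. -/
theorem stmt7 {X : Type u} [SemilatticeInf X] [TopologicalSpace X] [T2Space X]
    (hsep₁ : ∀ a : X, Continuous fun x : X => a ⊓ x)
    (hsep₂ : ∀ a : X, Continuous fun x : X => x ⊓ a) :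
    ChainCompact X ↔
      ∀ Z : Set X, IsClosed Z → (∀ a ∈ Z, ∀ b ∈ Z, a ⊓ b ∈ Z) →
        ∀ (Y : Type u) [SemilatticeInf Y] [TopologicalSpace Y] [T2Space Y],
          (Continuous fun p : Y × Y => p.1 ⊓ p.2) →
          ∀ h : X → Y, ContinuousOn h Z →
            (∀ a ∈ Z, ∀ b ∈ Z, h (a ⊓ b) = h a ⊓ h b) →
            IsClosed (h '' Z) := by
  exact ⟨fun hc Z hZ hZi Y _ _ _ hY h hh hom =>
    aux_forward hsep₁ hc Z hZ hZi Y hY h hh hom, fun H => aux_backward hsep₁ H⟩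
end

section
/- Let X be a chain-finite topologized semilattice and let Y be a semitopological semilattice (no separation axiom on Y is assumed). Then every T₁-multimorphism Φ : X ⊸ Y (i.e., every multimorphism with Φ(x) closed in Y for each x ∈ X; no upper semicontinuity is assumed) has closed image Φ(X) = ⋃_{x∈X} Φ(x) in Y. -/
open Set Topology

/-- A semilattice `X` is *chain-finite* if every chain in `X` is finite. -/
def ChainFinite (X : Type*) [SemilatticeInf X] : Prop :=
  ∀ C : Set X, IsChain (· ≤ ·) C → C.Finite

theorem ChainFinite.wf_lt {X : Type*} [SemilatticeInf X] (h : ChainFinite X) :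
    WellFounded ((· < ·) : X → X → Prop) := by
  rw [RelEmbedding.wellFounded_iff_isEmpty]
  refine ⟨fun f => ?_⟩
  have hf : StrictAnti f := fun a b hab => f.map_rel_iff.2 hab
  refine Set.infinite_range_of_injective hf.injective (h _ ?_)
  rintro _ ⟨a, rfl⟩ _ ⟨b, rfl⟩ _
  rcases le_total a b with hab | hab
  · exact Or.inr (hf.antitone hab)
  · exact Or.inl (hf.antitone hab)

theorem ChainFinite.wf_gt {X : Type*} [SemilatticeInf X] (h : ChainFinite X) :
    WellFounded ((· > ·) : X → X → Prop) := by
  rw [RelEmbedding.wellFounded_iff_isEmpty]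
  refine ⟨fun f => ?_⟩
  have hf : StrictMono f := fun a b hab => f.map_rel_iff.2 hab
  refine Set.infinite_range_of_injective hf.injective (h _ ?_)
  rintro _ ⟨a, rfl⟩ _ ⟨b, rfl⟩ _
  rcases le_total a b with hab | hab
  · exact Or.inl (hf.monotone hab)
  · exact Or.inr (hf.monotone hab)

/-- Every `T₁`-multimorphism from a chain-finite topologized semilattice to a
semitopological semilattice (no separation axiom assumed) has closed image. -/
theorem stmt8 {X Y : Type*} [SemilatticeInf X] [TopologicalSpace X]
    [SemilatticeInf Y] [TopologicalSpace Y]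
    (hYsep₁ : ∀ a : Y, Continuous fun y : Y => a ⊓ y)
    (hYsep₂ : ∀ a : Y, Continuous fun y : Y => y ⊓ a)
    (hXcf : ChainFinite X)
    (Φ : X → Set Y)
    (hmul : ∀ x x' : X, ∀ y ∈ Φ x, ∀ y' ∈ Φ x', y ⊓ y' ∈ Φ (x ⊓ x'))
    (hT1 : ∀ x : X, IsClosed (Φ x)) :
    IsClosed (⋃ x : X, Φ x) := by
  rw [← closure_subset_iff_isClosed]
  intro y hy
  -- the least element of `X`
  obtain ⟨x₀, hx₀⟩ : ∃ m : X, ∀ x, m ≤ x := by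
    obtain ⟨z, hz⟩ := closure_nonempty_iff.1 ⟨y, hy⟩
    obtain ⟨x, -⟩ := mem_iUnion.1 hz
    obtain ⟨m, -, hm⟩ := hXcf.wf_lt.has_min univ ⟨x, trivial⟩
    refine ⟨m, fun x => ?_⟩
    by_contra hx
    exact hm (m ⊓ x) trivial (inf_lt_left.2 hx)
  -- a maximal `x` such that `y` lies in the closure of the image of the upper set of `x`
  obtain ⟨x, hx, hmax⟩ := hXcf.wf_gt.has_min {x | y ∈ closure (⋃ z ∈ Ici x, Φ z)} ⟨x₀, by
    refine closure_mono ?_ hy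
    exact iUnion_subset fun z => subset_biUnion_of_mem (u := Φ) (mem_Ici.2 (hx₀ z))⟩
  by_contra hyS
  have hyx : y ∉ Φ x := fun h => hyS (mem_iUnion.2 ⟨x, h⟩)
  have key : ∀ U : Set Y, IsOpen U → y ∈ U → ∃ z, x ≤ z ∧ ∃ w ∈ Φ z, w ∈ U := by
    intro U hU hyU
    obtain ⟨w, hwU, hw⟩ := mem_closure_iff.1 hx U hU hyU
    simp only [mem_iUnion, mem_Ici] at hw
    obtain ⟨z, hz, hw⟩ := hw
    exact ⟨z, hz, w, hw, hwU⟩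
  have hO : IsOpen (Φ x)ᶜ := (hT1 x).isOpen_compl
  obtain ⟨x₁, ⟨hlt, v, hv, hyv⟩, hmin⟩ := hXcf.wf_lt.has_min
    {z | x < z ∧ ∃ v ∈ Φ z, y ⊓ v ∉ Φ x} (by
      obtain ⟨z, hz, w, hw, hw1, hw2⟩ := key ((fun v => y ⊓ v) ⁻¹' (Φ x)ᶜ ∩ (Φ x)ᶜ)
        ((hO.preimage (hYsep₁ y)).inter hO) ⟨by simpa using hyx, hyx⟩
      refine ⟨z, lt_of_le_of_ne hz ?_, w, hw, hw1⟩
      rintro rfl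
      exact hw2 hw)
  have hy1 : y ∉ closure (⋃ z ∈ Ici x₁, Φ z) := fun h => hmax x₁ h hlt
  obtain ⟨z, hz, w, hw, ⟨hw1, hw2⟩, hw3⟩ := key
    (((fun w => w ⊓ v) ⁻¹' (Φ x)ᶜ ∩ (fun w => w ⊓ (y ⊓ v)) ⁻¹' (Φ x)ᶜ) ∩
      (closure (⋃ z ∈ Ici x₁, Φ z))ᶜ)
    (((hO.preimage (hYsep₂ v)).inter (hO.preimage (hYsep₂ _))).inter
      isClosed_closure.isOpen_compl)
    ⟨⟨hyv, by simpa using hyv⟩, hy1⟩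
  have hwv := hmul z x₁ w hw v hv
  refine hmin (z ⊓ x₁) ⟨lt_of_le_of_ne (le_inf hz hlt.le) ?_, w ⊓ v, hwv, ?_⟩ ?_
  · intro h
    rw [← h] at hwv
    exact hw1 hwv
  · rw [inf_left_comm]
    exact hw2
  · refine inf_lt_right.2 fun h => hw3 (subset_closure ?_)
    exact mem_biUnion (mem_Ici.2 h) hw
end

section
/- Let X be a chain-finite topologized semilattice, let Z ⊆ X be a closed subsemilattice, and let h : Z → Y be a continuous semilattice homomorphism into a semitopological semilattice Y satisfying the separation axiom T₁ (all singletons of Y are closed). Then the image h(Z) is closed in Y. -/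
open Set Topology

theorem aux_ev {Y : Type*} [SemilatticeInf Y] [TopologicalSpace Y]
    (hY : ∀ a : Y, Continuous fun y : Y => y ⊓ a) (S : Set Y)
    (hS : ∀ a ∈ S, ∀ b ∈ S, a ⊓ b ∈ S) (t u : Y) (ht : t ∈ S) (htu : t ≤ u)
    (hcl : t ∉ closure (S ∩ Iio t)) : ∀ᶠ x in 𝓝 u, x ∈ S → t ≤ x := by
  have h1 : (closure (S ∩ Iio t))ᶜ ∈ 𝓝 (u ⊓ t) := by
    rw [inf_eq_right.2 htu]
    exact isClosed_closure.isOpen_compl.mem_nhds hcl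
  filter_upwards [(hY t).continuousAt.preimage_mem_nhds h1] with x hx hxS
  by_contra hn
  apply hx
  apply subset_closure
  refine ⟨hS x hxS t ht, lt_of_le_of_ne inf_le_right ?_⟩
  intro he
  exact hn (inf_eq_right.1 he)

theorem aux_notcl {Y : Type*} [SemilatticeInf Y] [TopologicalSpace Y] [T1Space Y]
    (hY : ∀ a : Y, Continuous fun y : Y => y ⊓ a) (S : Set Y)
    (hS : ∀ a ∈ S, ∀ b ∈ S, a ⊓ b ∈ S)
    (hmin : ∀ A ⊆ S, A.Nonempty → ∃ m ∈ A, ∀ a ∈ A, ¬ a < m)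
    (hmax : ∀ A ⊆ S, A.Nonempty → ∃ m ∈ A, ∀ a ∈ A, ¬ m < a) :
    ∀ u ∈ S, u ∉ closure (S ∩ Iio u) := by
  by_contra! hcon
  obtain ⟨u₀, hu₀⟩ := hcon
  obtain ⟨u, ⟨huS, hu⟩, hum⟩ := hmin {u | u ∈ S ∧ u ∈ closure (S ∩ Iio u)} (fun x hx => hx.1)
    ⟨u₀, hu₀⟩
  obtain ⟨m, ⟨hmS, hmu⟩, hm⟩ := hmax (S ∩ Iio u) inter_subset_left (closure_nonempty_iff.1 ⟨u, hu⟩)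
  have h1 := aux_ev hY S hS m u hmS (le_of_lt hmu) (fun hc => hum m ⟨hmS, hc⟩ hmu)
  have h2 : ∀ᶠ x in 𝓝 u, x ≠ m := isOpen_ne.mem_nhds (ne_of_gt hmu)
  obtain ⟨x, hx, hx1, hx2⟩ := ((mem_closure_iff_frequently.1 hu).and_eventually (h1.and h2)).exists
  exact hm x hx (lt_of_le_of_ne (hx1 hx.1) hx2.symm)

theorem aux_mem {Y : Type*} [SemilatticeInf Y] [TopologicalSpace Y] [T1Space Y]
    (hY : ∀ a : Y, Continuous fun y : Y => y ⊓ a) (S : Set Y)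
    (hS : ∀ a ∈ S, ∀ b ∈ S, a ⊓ b ∈ S)
    (hmin : ∀ A ⊆ S, A.Nonempty → ∃ m ∈ A, ∀ a ∈ A, ¬ a < m)
    (hmax : ∀ A ⊆ S, A.Nonempty → ∃ m ∈ A, ∀ a ∈ A, ¬ m < a)
    (y : Y) (hy : y ∈ closure S) (hev : ∀ᶠ x in 𝓝 y, x ∈ S → x ⊓ y ∈ S) : y ∈ S := by
  obtain ⟨x₀, hx₀, hx₀'⟩ := ((mem_closure_iff_frequently.1 hy).and_eventually hev).exists
  obtain ⟨s, ⟨hsS, hsy⟩, hsm⟩ := hmax (S ∩ Iic y) inter_subset_left ⟨x₀ ⊓ y, hx₀' hx₀, inf_le_right⟩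
  have h1 := aux_ev hY S hS s y hsS hsy (aux_notcl hY S hS hmin hmax s hsS)
  by_contra hyS
  have hne : y ⊓ y ≠ s := by
    rw [inf_idem]; rintro rfl; exact hyS hsS
  have h2 : ∀ᶠ x in 𝓝 y, x ⊓ y ≠ s :=
    (hY y).continuousAt.preimage_mem_nhds (isOpen_ne.mem_nhds hne)
  obtain ⟨x, hx, h1, h2, h3⟩ :=
    ((mem_closure_iff_frequently.1 hy).and_eventually (h1.and (h2.and hev))).exists
  exact hsm (x ⊓ y) ⟨h3 hx, inf_le_right⟩ (lt_of_le_of_ne (le_inf (h1 hx) hsy) h2.symm)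

theorem aux_closed {Y : Type*} [SemilatticeInf Y] [TopologicalSpace Y] [T1Space Y]
    (hY : ∀ a : Y, Continuous fun y : Y => y ⊓ a) (S : Set Y)
    (hS : ∀ a ∈ S, ∀ b ∈ S, a ⊓ b ∈ S)
    (hmin : ∀ A ⊆ S, A.Nonempty → ∃ m ∈ A, ∀ a ∈ A, ¬ a < m)
    (hmax : ∀ A ⊆ S, A.Nonempty → ∃ m ∈ A, ∀ a ∈ A, ¬ m < a) : IsClosed S := by
  have hmap : ∀ x ∈ S, ∀ y ∈ closure S, x ⊓ y ∈ closure (S ∩ Iic x) := by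
    intro x hx y hy
    rw [inf_comm]
    exact map_mem_closure (f := fun z => z ⊓ x) (hY x) hy (fun z hz => ⟨hS z hz x hx, inf_le_right⟩)
  have key : ∀ t ∈ S, closure (S ∩ Iic t) ⊆ S := by
    by_contra! hcon
    obtain ⟨t₀, ht₀⟩ := hcon
    obtain ⟨t, ⟨htS, ht⟩, htm⟩ := hmin {t | t ∈ S ∧ ¬ closure (S ∩ Iic t) ⊆ S} (fun x hx => hx.1)
      ⟨t₀, ht₀⟩
    apply ht
    intro y hy
    by_contra hyS
    have hyt : y ≠ t := by rintro rfl; exact hyS htS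
    have h2 : ∀ᶠ x in 𝓝 y, x ≠ t := isOpen_ne.mem_nhds hyt
    refine hyS (aux_mem hY (S ∩ Iic t) ?_ ?_ ?_ y hy ?_).1
    · exact fun a ha b hb => ⟨hS a ha.1 b hb.1, inf_le_left.trans ha.2⟩
    · exact fun A hA => hmin A (hA.trans inter_subset_left)
    · exact fun A hA => hmax A (hA.trans inter_subset_left)
    · filter_upwards [h2] with x hxt hx
      refine ⟨?_, inf_le_left.trans hx.2⟩
      by_contra hn
      exact htm x ⟨hx.1, fun hsub => hn (hsub (hmap x hx.1 y (closure_mono inter_subset_left hy)))⟩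
        (lt_of_le_of_ne hx.2 hxt)
  refine isClosed_of_closure_subset fun y hy => aux_mem hY S hS hmin hmax y hy ?_
  exact Filter.Eventually.of_forall fun x hx => key x hx (hmap x hx y hy)

theorem aux_wf_lt {X : Type*} [SemilatticeInf X] (hX : ChainFinite X) :
    WellFounded (fun a b : X => a < b) := by
  rw [RelEmbedding.wellFounded_iff_isEmpty]
  refine ⟨fun f => ?_⟩
  refine Set.infinite_range_of_injective f.injective (hX _ ?_)
  have hf : StrictAnti f := fun a b hab => f.map_rel_iff.2 hab
  rintro _ ⟨a, rfl⟩ _ ⟨b, rfl⟩ -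
  rcases le_total a b with hab | hab
  · exact Or.inr (hf.antitone hab)
  · exact Or.inl (hf.antitone hab)

theorem aux_wf_gt {X : Type*} [SemilatticeInf X] (hX : ChainFinite X) :
    WellFounded (fun a b : X => b < a) := by
  rw [RelEmbedding.wellFounded_iff_isEmpty]
  refine ⟨fun f => ?_⟩
  refine Set.infinite_range_of_injective f.injective (hX _ ?_)
  have hf : StrictMono f := fun a b hab => f.map_rel_iff.2 hab
  rintro _ ⟨a, rfl⟩ _ ⟨b, rfl⟩ -
  rcases le_total a b with hab | hab
  · exact Or.inl (hf.monotone hab)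
  · exact Or.inr (hf.monotone hab)

/-- If `X` is a chain-finite topologized semilattice, `Z ⊆ X` is a closed subsemilattice
and `h : Z → Y` is a continuous semilattice homomorphism into a `T₁` semitopological
semilattice `Y`, then the image `h(Z)` is closed in `Y`. -/
theorem stmt9 {X Y : Type*} [SemilatticeInf X] [TopologicalSpace X]
    [SemilatticeInf Y] [TopologicalSpace Y] [T1Space Y]
    (hYsep₁ : ∀ a : Y, Continuous fun y : Y => a ⊓ y)
    (hYsep₂ : ∀ a : Y, Continuous fun y : Y => y ⊓ a)
    (hXcf : ChainFinite X)
    (Z : Set X) (hZcl : IsClosed Z) (hZsub : ∀ a ∈ Z, ∀ b ∈ Z, a ⊓ b ∈ Z)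
    (h : X → Y) (hc : ContinuousOn h Z)
    (hhom : ∀ a ∈ Z, ∀ b ∈ Z, h (a ⊓ b) = h a ⊓ h b) :
    IsClosed (h '' Z) := by
  rcases Z.eq_empty_or_nonempty with rfl | ⟨z₀, hz₀⟩
  · simp
  have : Nonempty X := ⟨z₀⟩
  have wl := aux_wf_lt hXcf
  have wg := aux_wf_gt hXcf
  have hex : ∀ y ∈ h '' Z, ∃ e : X, e ∈ Z ∧ h e = y ∧ ∀ x ∈ Z, h x = y → e ≤ x := by
    rintro y ⟨z, hz, hzy⟩
    obtain ⟨e, ⟨heZ, hey⟩, hem⟩ := wl.has_min {x | x ∈ Z ∧ h x = y} ⟨z, hz, hzy⟩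
    refine ⟨e, heZ, hey, fun x hx hxy => ?_⟩
    by_contra hn
    refine hem (e ⊓ x) ⟨hZsub e heZ x hx, ?_⟩
      (lt_of_le_of_ne inf_le_left fun he => hn (inf_eq_left.1 he))
    rw [hhom e heZ x hx, hey, hxy, inf_idem]
  choose! e heZ hey hem using hex
  have hmono : ∀ a ∈ h '' Z, ∀ b ∈ h '' Z, a < b → e a < e b := by
    intro a ha b hb hab
    refine lt_of_le_of_ne ?_ ?_
    · refine le_trans (hem a ha (e a ⊓ e b) (hZsub _ (heZ a ha) _ (heZ b hb)) ?_) inf_le_right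
      rw [hhom _ (heZ a ha) _ (heZ b hb), hey a ha, hey b hb, inf_eq_left.2 hab.le]
    · intro he
      apply hab.ne
      rw [← hey a ha, ← hey b hb, he]
  refine aux_closed hYsep₂ (h '' Z) ?_ ?_ ?_
  · rintro _ ⟨a, ha, rfl⟩ _ ⟨b, hb, rfl⟩
    exact ⟨a ⊓ b, hZsub a ha b hb, hhom a ha b hb⟩
  · intro A hA hne
    obtain ⟨_, ⟨m, hm, rfl⟩, hmm⟩ := wl.has_min (e '' A) (hne.image e)
    exact ⟨m, hm, fun a ha hlt => hmm (e a) ⟨a, ha, rfl⟩ (hmono a (hA ha) m (hA hm) hlt)⟩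
  · intro A hA hne
    obtain ⟨_, ⟨m, hm, rfl⟩, hmm⟩ := wg.has_min (e '' A) (hne.image e)
    exact ⟨m, hm, fun a ha hlt => hmm (e a) ⟨a, ha, rfl⟩ (hmono m (hA hm) a (hA ha) hlt)⟩
end

section
/- Let X be a Hausdorff semitopological semilattice such that every closed countable chain C ⊆ X (regarded as a semitopological semilattice with the subspace topology and the induced meet operation) has the property that for every isomorphic topological embedding f of C into a semitopological semilattice Y satisfying the separation axiom T₁, the image f(C) is closed in Y. Then X is chain-finite. -/
open Set Topology

universe u

open Filter

/-- Topology in which the points outside `L` are isolated and the points of `L` have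
neighbourhoods given by the filter `G`. -/
def limTop {Y : Type*} (L : Set Y) (G : Filter Y) : TopologicalSpace Y where
  IsOpen U := ∀ y ∈ L, y ∈ U → U ∈ G
  isOpen_univ := fun _ _ _ => univ_mem
  isOpen_inter := fun s t hs ht y hy hyU => inter_mem (hs y hy hyU.1) (ht y hy hyU.2)
  isOpen_sUnion := fun s hs y hy hyU => by
    obtain ⟨t, ht, hyt⟩ := hyU
    exact mem_of_superset (hs t ht y hy hyt) (subset_sUnion_of_mem ht)

theorem core {X : Type u} [SemilatticeInf X] [TopologicalSpace X]
    (H : ∀ C : Set X, IsClosed C → C.Countable → IsChain (· ≤ ·) C →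
      ∀ (Y : Type u) [SemilatticeInf Y] [TopologicalSpace Y] [T1Space Y],
        (∀ a : Y, Continuous fun y : Y => a ⊓ y) →
        (∀ a : Y, Continuous fun y : Y => y ⊓ a) →
        ∀ f : X → Y,
          (∀ a ∈ C, ∀ b ∈ C, f (a ⊓ b) = f a ⊓ f b) →
          Set.InjOn f C →
          IsEmbedding (fun c : C => f c) →
          IsClosed (f '' C))
    (C : Set X) (hCc : IsClosed C) (hCch : IsChain (· ≤ ·) C)
    (x : ℕ → X) (hx : Function.Injective x) (hxC : ∀ n, x n ∈ C)
    (F : Filter ℕ) [F.NeBot]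
    (huniq : ∀ z ∈ C, ∀ w ∈ C, z ∉ range x → w ∉ range x → z = w)
    (hF : ∀ z ∈ C, z ∉ range x → F = comap x (𝓝 z))
    (hiso : ∀ n, ∃ V, IsOpen V ∧ x n ∈ V ∧ ∀ z ∈ C, z ∈ V → z = x n)
    (Y : Type u) [SemilatticeInf Y] (L : Set Y) (G : Filter Y) (hG : G ≤ cofinite)
    (hcont : ∀ a, ∀ y ∈ L, (a ⊓ y ∈ L ∧ Tendsto (fun z => a ⊓ z) G G) ∨
      (∀ᶠ z in G, a ⊓ z = a ⊓ y))
    (e : ℕ → Y) (he : Function.Injective e) (w p : Y) (hw : w ∈ L) (hp : p ∈ L)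
    (hwp : w ≠ p) (heL : ∀ n, e n ∉ L) (h1 : Tendsto e F G)
    (h2 : ∀ S : Set Y, (∀ᶠ n in F, e n ∈ S) → (∀ y, y ∉ range e → y ∈ S) → S ∈ G)
    (hm : ∀ n m, x n ≤ x m → e n ≤ e m)
    (hm1 : ∀ z ∈ C, z ∉ range x → ∀ n, x n ≤ z → e n ≤ w)
    (hm2 : ∀ z ∈ C, z ∉ range x → ∀ n, z ≤ x n → w ≤ e n) : False := by
  letI : TopologicalSpace Y := limTop L G
  have hopen : ∀ U : Set Y, IsOpen U ↔ ∀ y ∈ L, y ∈ U → U ∈ G := fun U => Iff.rfl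
  haveI : T1Space Y := ⟨fun y => by
    rw [← isOpen_compl_iff, hopen]
    intro _ _ _
    exact hG (by simp)⟩
  have hc : ∀ a : Y, Continuous fun y : Y => a ⊓ y := by
    intro a
    refine ⟨fun U hU => ?_⟩
    rw [hopen]
    intro y hy hyU
    rcases hcont a y hy with ⟨h, ht⟩ | h
    · exact ht ((hopen U).1 hU _ h hyU)
    · filter_upwards [h] with z hz
      change a ⊓ z ∈ U
      rw [hz]; exact hyU
  set f : X → Y := Function.extend x e (fun _ => w) with hf
  have fx : ∀ n, f (x n) = e n := fun n => hx.extend_apply e _ n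
  have fz : ∀ z, z ∉ range x → f z = w := fun z hz => by
    rw [hf, Function.extend_apply' _ _ _ (by simpa using hz)]
  have ewne : ∀ n, e n ≠ w := fun n h => heL n (h ▸ hw)
  have hCcount : C.Countable := by
    have : C ⊆ range x ∪ (C \ range x) := fun z hz => by
      by_cases h : z ∈ range x
      · exact Or.inl h
      · exact Or.inr ⟨hz, h⟩
    refine Set.Countable.mono this ((countable_range x).union ?_)
    exact Set.Subsingleton.countable fun z hz v hv => huniq z hz.1 v hv.1 hz.2 hv.2
  have hinj : Set.InjOn f C := by
    intro a ha b hb hab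
    by_cases h : a ∈ range x <;> by_cases h' : b ∈ range x
    · obtain ⟨n, rfl⟩ := h
      obtain ⟨m, rfl⟩ := h'
      rw [fx, fx] at hab
      rw [he hab]
    · obtain ⟨n, rfl⟩ := h
      rw [fx, fz b h'] at hab
      exact absurd hab (ewne n)
    · obtain ⟨n, rfl⟩ := h'
      rw [fx, fz a h] at hab
      exact absurd hab.symm (ewne n)
    · exact huniq a ha b hb h h'
  have hmono : ∀ a ∈ C, ∀ b ∈ C, a ≤ b → f a ≤ f b := by
    intro a ha b hb hab
    by_cases h : a ∈ range x <;> by_cases h' : b ∈ range x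
    · obtain ⟨n, rfl⟩ := h
      obtain ⟨m, rfl⟩ := h'
      rw [fx, fx]
      exact hm _ _ hab
    · obtain ⟨n, rfl⟩ := h
      rw [fx, fz b h']
      exact hm1 b hb h' n hab
    · obtain ⟨n, rfl⟩ := h'
      rw [fx, fz a h]
      exact hm2 a ha h n hab
    · rw [fz a h, fz b h']
  have hhom : ∀ a ∈ C, ∀ b ∈ C, f (a ⊓ b) = f a ⊓ f b := by
    intro a ha b hb
    rcases hCch.total ha hb with h | h
    · rw [inf_eq_left.2 h, inf_eq_left.2 (hmono a ha b hb h)]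
    · rw [inf_eq_right.2 h, inf_eq_right.2 (hmono b hb a ha h)]
  have hind : IsInducing (fun c : C => f c) := by
    refine ⟨?_⟩
    apply le_antisymm
    · rw [← continuous_iff_le_induced]
      rw [continuous_def]
      intro U hU
      rw [isOpen_iff_mem_nhds]
      rintro ⟨z, hz⟩ hzU
      have hzU : f z ∈ U := hzU
      rw [nhds_subtype_eq_comap]
      by_cases h : z ∈ range x
      · obtain ⟨n, rfl⟩ := h
        obtain ⟨V, hV, hnV, hVC⟩ := hiso n
        refine ⟨V, hV.mem_nhds hnV, ?_⟩
        rintro ⟨v, hv⟩ hvV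
        have : v = x n := hVC v hv hvV
        subst this
        exact hzU
      · have hUG := (hopen U).1 hU w hw (by rwa [fz z h] at hzU)
        have h3 : ∀ᶠ n in F, e n ∈ U := h1 hUG
        rw [hF z hz h] at h3
        obtain ⟨W, hW, hWU⟩ := h3
        refine ⟨W, hW, ?_⟩
        rintro ⟨v, hv⟩ hvW
        change f v ∈ U
        by_cases hv' : v ∈ range x
        · obtain ⟨n, rfl⟩ := hv'
          rw [fx]
          exact hWU hvW
        · rw [fz v hv', ← fz z h]; exact hzU
    · rintro V ⟨V', hV', rfl⟩
      by_cases hz : ∃ z ∈ C, z ∉ range x ∧ z ∈ V'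
      · obtain ⟨z, hzC, hzx, hzV⟩ := hz
        refine ⟨{y | ∀ n, e n = y → x n ∈ V'}, ?_, ?_⟩
        · rw [hopen]
          intro y _ _
          apply h2
          · rw [hF z hzC hzx]
            refine ⟨V', hV'.mem_nhds hzV, ?_⟩
            intro n hn m hmn
            rw [he hmn]; exact hn
          · intro y hy n hn
            exact absurd ⟨n, hn⟩ hy
        · ext ⟨v, hv⟩
          simp only [mem_preimage, mem_ofPred_eq]
          by_cases hv' : v ∈ range x
          · obtain ⟨n, rfl⟩ := hv'
            rw [fx]
            exact ⟨fun h => h n rfl, fun h m hmn => by rw [he hmn]; exact h⟩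
          · rw [fz v hv', huniq v hv z hzC hv' hzx]
            exact ⟨fun _ => hzV, fun _ n hn => absurd hn (ewne n)⟩
      · refine ⟨{y | ∃ n, e n = y ∧ x n ∈ V'}, ?_, ?_⟩
        · rw [hopen]
          rintro y hy ⟨n, rfl, _⟩
          exact absurd hy (heL n)
        · ext ⟨v, hv⟩
          simp only [mem_preimage, mem_ofPred_eq]
          by_cases hv' : v ∈ range x
          · obtain ⟨n, rfl⟩ := hv'
            rw [fx]
            exact ⟨fun ⟨m, hmn, h⟩ => by rw [← he hmn]; exact h, fun h => ⟨n, rfl, h⟩⟩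
          · rw [fz v hv']
            exact ⟨fun ⟨n, hn, _⟩ => absurd hn (ewne n), fun h => absurd ⟨v, hv, hv', h⟩ hz⟩
  have hemb : IsEmbedding (fun c : C => f c) :=
    ⟨hind, fun a b hab => Subtype.ext (hinj a.2 b.2 hab)⟩
  have hcl := H C hCc hCcount hCch Y hc (fun a => by simpa only [inf_comm] using hc a)
    f hhom hinj hemb
  have hpn : p ∈ (f '' C)ᶜ := by
    rintro ⟨z, _, hzp⟩
    by_cases h : z ∈ range x
    · obtain ⟨n, rfl⟩ := h
      rw [fx] at hzp
      exact heL n (hzp ▸ hp)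
    · rw [fz z h] at hzp
      exact hwp hzp
  have h4 := h1 ((hopen _).1 hcl.isOpen_compl p hp hpn)
  obtain ⟨n, hn⟩ := F.nonempty_of_mem h4
  exact hn ⟨x n, hxC n, fx n⟩

/-- The closure of a sequence strictly monotone for an order-like relation. -/
theorem seqFacts {X : Type u} [TopologicalSpace X] [T1Space X] (r : X → X → Prop)
    (hant : ∀ a b, r a b → r b a → a = b)
    (hc1 : ∀ a, IsClosed {y | r a y}) (hc2 : ∀ a, IsClosed {y | r y a})
    (x : ℕ → X) (hr : ∀ m n, r (x m) (x n) ↔ m ≤ n) :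
    (∀ z ∈ closure (range x), z ∉ range x → ∀ n, r (x n) z) ∧
    (∀ z ∈ closure (range x), ∀ w ∈ closure (range x), z ∉ range x → w ∉ range x → z = w) ∧
    (∀ n, ∃ V, IsOpen V ∧ x n ∈ V ∧ ∀ z ∈ closure (range x), z ∈ V → z = x n) ∧
    ∃ F : Filter ℕ, F.NeBot ∧ F ≤ atTop ∧
      ∀ z ∈ closure (range x), z ∉ range x → F = comap x (𝓝 z) := by
  have A : ∀ z ∈ closure (range x), z ∉ range x → ∀ n, r (x n) z := by
    intro z hz hzr n
    have hcl : IsClosed (x '' Iic n ∪ {y | r (x n) y}) :=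
      ((finite_Iic n).image x).isClosed.union (hc1 _)
    have hsub : range x ⊆ x '' Iic n ∪ {y | r (x n) y} := by
      rintro _ ⟨m, rfl⟩
      rcases le_total m n with h | h
      · exact Or.inl ⟨m, h, rfl⟩
      · exact Or.inr ((hr _ _).2 h)
    rcases closure_minimal hsub hcl hz with ⟨m, _, hm⟩ | h
    · exact absurd ⟨m, hm⟩ hzr
    · exact h
  have B : ∀ z ∈ closure (range x), ∀ w ∈ closure (range x), z ∉ range x → w ∉ range x →
      r w z := by
    intro z hz w hw hzr _
    have hsub : range x ⊆ {y | r y z} := by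
      rintro _ ⟨m, rfl⟩
      exact A z hz hzr m
    exact closure_minimal hsub (hc2 z) hw
  have B' : ∀ z ∈ closure (range x), ∀ w ∈ closure (range x), z ∉ range x → w ∉ range x →
      z = w := fun z hz w hw h h' => hant _ _ (B w hw z hz h' h) (B z hz w hw h h')
  have hinj : Function.Injective x := fun m n h =>
    le_antisymm ((hr m n).1 (h ▸ (hr m m).2 le_rfl)) ((hr n m).1 (h ▸ (hr m m).2 le_rfl))
  refine ⟨A, B', ?_, ?_⟩
  · intro n
    refine ⟨(x '' Iio n ∪ {y | r (x (n+1)) y})ᶜ, ?_, ?_, ?_⟩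
    · exact (((finite_Iio n).image x).isClosed.union (hc1 _)).isOpen_compl
    · rintro (⟨m, hm, h⟩ | h)
      · exact absurd (hinj h) (ne_of_lt hm)
      · have := (hr _ _).1 h
        omega
    · intro z hz hzV
      by_cases h : z ∈ range x
      · obtain ⟨m, rfl⟩ := h
        have h1 : ¬ m < n := fun h => hzV (Or.inl ⟨m, h, rfl⟩)
        have h2 : ¬ n + 1 ≤ m := fun h => hzV (Or.inr ((hr _ _).2 h))
        rw [show m = n by omega]
      · exact absurd (Or.inr (A z hz h (n+1))) hzV
  · by_cases hz : ∃ z ∈ closure (range x), z ∉ range x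
    · obtain ⟨z, hz, hzr⟩ := hz
      refine ⟨comap x (𝓝 z), ?_, ?_, ?_⟩
      · exact comap_neBot_iff_frequently.2 (mem_closure_iff_frequently.1 hz)
      · rw [← Nat.cofinite_eq_atTop, le_cofinite_iff_compl_singleton_mem]
        intro n
        refine ⟨{x n}ᶜ, isOpen_compl_singleton.mem_nhds (fun h => hzr ⟨n, h.symm⟩), ?_⟩
        intro m hm hmn
        exact hm (by rw [hmn]; rfl)
      · intro w hw hwr
        rw [B' z hz w hw hzr hwr]
    · exact ⟨atTop, inferInstance, le_rfl, fun z h h' => absurd ⟨z, h, h'⟩ hz⟩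

theorem seqChain {X : Type u} [PartialOrder X] [TopologicalSpace X] (r : X → X → Prop)
    (hrl : ∀ a b, r a b → a ≤ b ∨ b ≤ a)
    (x : ℕ → X) (hr : ∀ m n, r (x m) (x n) ↔ m ≤ n)
    (h1 : ∀ z ∈ closure (range x), z ∉ range x → ∀ n, r (x n) z)
    (h2 : ∀ z ∈ closure (range x), ∀ w ∈ closure (range x), z ∉ range x → w ∉ range x → z = w) :
    IsChain (· ≤ ·) (closure (range x)) := by
  intro a ha b hb _
  by_cases h : a ∈ range x <;> by_cases h' : b ∈ range x
  · obtain ⟨n, rfl⟩ := h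
    obtain ⟨m, rfl⟩ := h'
    rcases le_total n m with h | h
    · exact hrl _ _ ((hr _ _).2 h)
    · exact (hrl _ _ ((hr _ _).2 h)).symm
  · obtain ⟨n, rfl⟩ := h
    exact hrl _ _ (h1 b hb h' n)
  · obtain ⟨n, rfl⟩ := h'
    exact (hrl _ _ (h1 a ha h n)).symm
  · exact Or.inl (h2 a ha b hb h h').le

/-- If in a Hausdorff semitopological semilattice `X` every closed countable chain `C`
has the property that every isomorphic topological embedding of `C` into a `T₁`
semitopological semilattice has closed image, then `X` is chain-finite. -/
theorem stmt12 {X : Type u} [SemilatticeInf X] [TopologicalSpace X] [T2Space X]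
    (hsep₁ : ∀ a : X, Continuous fun x : X => a ⊓ x)
    (hsep₂ : ∀ a : X, Continuous fun x : X => x ⊓ a)
    (H : ∀ C : Set X, IsClosed C → C.Countable → IsChain (· ≤ ·) C →
      ∀ (Y : Type u) [SemilatticeInf Y] [TopologicalSpace Y] [T1Space Y],
        (∀ a : Y, Continuous fun y : Y => a ⊓ y) →
        (∀ a : Y, Continuous fun y : Y => y ⊓ a) →
        ∀ f : X → Y,
          (∀ a ∈ C, ∀ b ∈ C, f (a ⊓ b) = f a ⊓ f b) →
          Set.InjOn f C →
          IsEmbedding (fun c : C => f c) →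
          IsClosed (f '' C)) :
    ChainFinite X := by
  intro C hC
  by_contra hinf
  have hup : ∀ a : X, IsClosed {y | a ≤ y} := fun a => by
    simpa only [inf_eq_left] using isClosed_eq (hsep₁ a) (continuous_const (y := a))
  have hdn : ∀ a : X, IsClosed {y | y ≤ a} := fun a => by
    simpa only [inf_eq_left, id] using isClosed_eq (hsep₂ a) continuous_id
  have : Infinite C := Set.infinite_coe_iff.2 hinf
  let s : ℕ ↪ C := Infinite.natEmbedding C
  obtain ⟨g, hg⟩ := exists_increasing_or_nonincreasing_subseq (fun a b : X => a < b)
    (fun n => (s n : X))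
  rcases hg with hg | hg
  · -- strictly increasing
    let x : ℕ → X := fun n => s (g n)
    have hx : StrictMono x := fun m n h => hg m n h
    have hr : ∀ m n, x m ≤ x n ↔ m ≤ n := fun m n => hx.le_iff_le
    obtain ⟨h1, h2, h3, F, hF, hFc, hFz⟩ := seqFacts (fun a b : X => a ≤ b)
      (fun a b => le_antisymm) hup hdn x hr
    have hch := seqChain (fun a b : X => a ≤ b) (fun a b h => Or.inl h) x hr h1 h2
    let c : ℕ → WithTop (WithTop (ULift.{u} ℕ)) := fun n => (((ULift.up.{u} n : ULift.{u} ℕ) : WithTop (ULift.{u} ℕ)) : WithTop (WithTop (ULift.{u} ℕ)))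
    have hcinj : Function.Injective c := fun m n h => by simpa [c] using h
    have hle : ∀ m n, c m ≤ c n ↔ m ≤ n := by
      intro m n; simp [c]
    let w : WithTop (WithTop (ULift.{u} ℕ)) := ((⊤ : WithTop (ULift.{u} ℕ)) : WithTop _)
    have hcw : ∀ n, c n < w := fun n => by simp [c, w]
    have hwt : w < ⊤ := by simp [w]
    have hall : ∀ y, (∃ n, y = c n) ∨ y = w ∨ y = ⊤ := by
      intro y
      induction y using WithTop.recTopCoe with
      | top => simp
      | coe y =>
        induction y using WithTop.recTopCoe with
        | top => exact Or.inr (Or.inl rfl)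
        | coe y => exact Or.inl ⟨y.down, rfl⟩
    refine core H _ isClosed_closure hch x hx.injective (fun n => subset_closure ⟨n, rfl⟩)
      F h2 hFz h3 (WithTop (WithTop (ULift.{u} ℕ))) {w, ⊤} (map c F) ?_ ?_ c hcinj w ⊤
      (by simp) (by simp) hwt.ne ?_ tendsto_map ?_ ?_ ?_ ?_
    · have := hcinj.tendsto_cofinite
      rw [Nat.cofinite_eq_atTop] at this
      exact this.mono_left hFc
    · intro a y hy
      rcases hall a with ⟨n, rfl⟩ | rfl | rfl
      · right
        rw [eventually_map]
        filter_upwards [hFc (eventually_ge_atTop n)] with m hm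
        rw [inf_eq_left.2 ((hle _ _).2 hm)]
        rcases hy with rfl | rfl
        · rw [inf_eq_left.2 (hcw n).le]
        · simp
      · left
        refine ⟨?_, ?_⟩
        · rcases hy with rfl | rfl <;> simp
        · rw [tendsto_map'_iff]
          refine tendsto_map.congr fun n => ?_
          simp [(hcw n).le]
      · left
        refine ⟨by simpa using hy, ?_⟩
        simp only [top_inf_eq]
        exact tendsto_id
    · rintro n (h | h)
      · exact (hcw n).ne h
      · exact ((hcw n).trans hwt).ne h
    · intro S hS _
      exact hS
    · intro n m h
      rw [hle]; exact (hr _ _).1 h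
    · intro z _ _ n _
      exact (hcw n).le
    · intro z hz hzr n h
      exact absurd ⟨n, le_antisymm (h1 z hz hzr n) h⟩ hzr
  · -- strictly decreasing
    let x : ℕ → X := fun n => s (g n)
    have hx : StrictAnti x := fun m n h => by
      have h' := hg m n h
      have hne : x m ≠ x n := fun he => by
        have : g m = g n := s.injective (Subtype.ext he)
        exact h.ne (g.injective this)
      rcases hC.total (s (g m)).2 (s (g n)).2 with hle | hle
      · exact absurd (lt_of_le_of_ne hle hne) h'
      · exact lt_of_le_of_ne hle hne.symm
    have hr : ∀ m n, x n ≤ x m ↔ m ≤ n := fun m n => hx.le_iff_ge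
    obtain ⟨h1, h2, h3, F, hF, hFc, hFz⟩ := seqFacts (fun a b : X => b ≤ a)
      (fun a b h h' => le_antisymm h' h) hdn hup x hr
    have hch := seqChain (fun a b : X => b ≤ a) (fun a b h => Or.inr h) x hr h1 h2
    let d : Bool → ℕ → WithBot ((ULift.{u} ℕ)ᵒᵈ × Bool) :=
      fun b n => ((OrderDual.toDual (ULift.up n), b) : (ULift.{u} ℕ)ᵒᵈ × Bool)
    have hdinj : ∀ b, Function.Injective (d b) := fun b m n h => by simpa [d] using h
    have hd : ∀ a b m n, d a m = d b n ↔ m = n ∧ a = b := by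
      intro a b m n; simp [d]
    have hinf : ∀ a b m n, d a m ⊓ d b n = d (a ⊓ b) (m ⊔ n) := by
      intro a b m n
      rfl
    have hall : ∀ y, (∃ b n, y = d b n) ∨ y = ⊥ := by
      intro y
      induction y using WithBot.recBotCoe with
      | bot => simp
      | coe y => exact Or.inl ⟨y.2, y.1.down, rfl⟩
    have hbot : ∀ b n, d b n ≠ ⊥ := fun b n => WithBot.coe_ne_bot
    have key : ∀ b : Bool, ∀ k, Tendsto (fun z => d b k ⊓ z) (map (d true) F ⊔ map (d false) F)
        (map (d true) F ⊔ map (d false) F) := by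
      have key' : ∀ b b' : Bool, ∀ k, Tendsto (fun n => d b k ⊓ d b' n) F
          (map (d true) F ⊔ map (d false) F) := by
        intro b b' k
        have : Tendsto (d (b ⊓ b')) F (map (d true) F ⊔ map (d false) F) := by
          cases (b ⊓ b')
          · exact tendsto_map.mono_right le_sup_right
          · exact tendsto_map.mono_right le_sup_left
        refine this.congr' ?_
        filter_upwards [hFc (eventually_ge_atTop k)] with m hm
        rw [hinf, sup_eq_right.2 hm]
      intro b k
      rw [tendsto_sup]
      exact ⟨tendsto_map'_iff.2 (key' b true k), tendsto_map'_iff.2 (key' b false k)⟩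
    refine core H _ isClosed_closure hch x hx.injective (fun n => subset_closure ⟨n, rfl⟩)
      F h2 hFz h3 (WithBot ((ULift.{u} ℕ)ᵒᵈ × Bool)) (range (d true))ᶜ
      (map (d true) F ⊔ map (d false) F) ?_ ?_ (d true) (hdinj true) ⊥ (d false 0)
      ?_ ?_ (hbot _ _).symm ?_ (tendsto_map.mono_right le_sup_left) ?_ ?_ ?_ ?_
    · have hb : ∀ b, map (d b) F ≤ cofinite := fun b => by
        have := (hdinj b).tendsto_cofinite
        rw [Nat.cofinite_eq_atTop] at this
        exact this.mono_left hFc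
      exact sup_le (hb _) (hb _)
    · intro a y hy
      rcases hall a with ⟨b, n, rfl⟩ | rfl
      · left
        refine ⟨?_, key b n⟩
        rcases hall y with ⟨b', m, rfl⟩ | rfl
        · cases b'
          · rw [hinf]
            rintro ⟨k, hk⟩
            rw [hd] at hk
            simp at hk
          · exact absurd ⟨m, rfl⟩ hy
        · rw [inf_bot_eq]
          exact hy
      · right
        simp
    · rintro ⟨n, hn⟩
      exact hbot _ _ hn
    · rintro ⟨n, hn⟩
      exact absurd ((hd _ _ _ _).1 hn).2 (by simp)
    · intro n h
      exact h ⟨n, rfl⟩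
    · intro S hS hS'
      refine mem_sup.2 ⟨hS, ?_⟩
      refine mem_map.2 (univ_mem' fun n => hS' _ ?_)
      rintro ⟨m, hm⟩
      exact absurd ((hd _ _ _ _).1 hm).2 (by simp)
    · intro n m h
      rw [← inf_eq_left, hinf, sup_eq_left.2 ((hr _ _).1 h)]
      rfl
    · intro z hz hzr n h
      exact absurd ⟨n, le_antisymm h (h1 z hz hzr n)⟩ hzr
    · intro z _ _ n _
      exact bot_le
end

section
/- Let X be a semitopological semilattice satisfying the separation axiom T₁ such that for every isomorphic topological embedding f of X into a semitopological semilattice Y satisfying T₁ the image f(X) is closed in Y. Then for every p ∈ X the upper cone ↑p = {x ∈ X : p ≤ x} is open in X. -/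
open Set Topology

universe u

/-- `X` with one extra point `none`, placed immediately below `p`. -/
def PExt {X : Type u} (_p : X) : Type u := Option X

namespace PExt

variable {X : Type u} [SemilatticeInf X]

open Classical in
/-- The meet on the extension. -/
noncomputable def meet (p : X) : Option X → Option X → Option X
  | some x, some y => some (x ⊓ y)
  | none, some y => if p ≤ y then none else some (p ⊓ y)
  | some x, none => if p ≤ x then none else some (p ⊓ x)
  | none, none => none

theorem meet_comm (p : X) (a b : Option X) : meet p a b = meet p b a := by
  cases a <;> cases b <;> simp [meet, inf_comm]

theorem meet_assoc (p : X) (a b c : Option X) :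
    meet p (meet p a b) c = meet p a (meet p b c) := by
  rcases a with _ | a <;> rcases b with _ | b <;> rcases c with _ | c <;>
    simp only [meet]
  · by_cases h : p ≤ c <;> simp [meet, h]
  · by_cases h : p ≤ b <;> simp [meet, h]
  · by_cases h : p ≤ b <;> by_cases h' : p ≤ c <;> simp [meet, h, h', inf_assoc]
    rw [← inf_assoc, inf_eq_left.2 h]
  · by_cases h : p ≤ a <;> simp [meet, h]
  · by_cases h : p ≤ a <;> by_cases h' : p ≤ c <;> simp [meet, h, h', inf_assoc]
    · exact inf_le_left.trans h
    · rw [inf_comm a c, ← inf_assoc, inf_eq_left.2 h']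
    · rw [inf_left_comm]
  · by_cases h : p ≤ a <;> by_cases h' : p ≤ b <;> simp [meet, h, h', inf_assoc]
    · rw [inf_left_comm]
    · rw [inf_left_comm, inf_eq_left.2 h', inf_comm]
    · rw [inf_left_comm]
  · rw [inf_assoc]

theorem meet_idem (p : X) (a : Option X) : meet p a a = a := by
  cases a <;> simp [meet]

noncomputable instance (p : X) : SemilatticeInf (PExt p) :=
  letI : Min (PExt p) := ⟨meet p⟩
  SemilatticeInf.mk' (meet_comm p) (meet_assoc p) (meet_idem p)

/-- The inclusion. -/
def inc (p x : X) : PExt p := (some x : Option X)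

/-- The new point. -/
def pt (p : X) : PExt p := (none : Option X)

theorem cases_pt {p : X} (a : PExt p) : a = pt p ∨ ∃ x, a = inc p x := by
  rcases a with _ | x
  · exact Or.inl rfl
  · exact Or.inr ⟨x, rfl⟩

theorem inc_inj (p : X) : Function.Injective (inc p) := fun _ _ h => Option.some.inj h

theorem inc_ne (p x : X) : inc p x ≠ pt p := fun h => Option.some_ne_none x h

theorem inc_inf (p x y : X) : inc p (x ⊓ y) = inc p x ⊓ inc p y := rfl

theorem pt_inf_of_le {p x : X} (h : p ≤ x) : pt p ⊓ inc p x = pt p := by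
  change meet p none (some x) = none
  simp [meet, h]

theorem pt_inf_of_not_le {p x : X} (h : ¬ p ≤ x) : pt p ⊓ inc p x = inc p (p ⊓ x) := by
  change meet p none (some x) = some _
  simp [meet, h]

variable [TopologicalSpace X]

instance (p : X) : TopologicalSpace (PExt p) where
  IsOpen W := IsOpen {x | inc p x ∈ W} ∧
    (pt p ∈ W → ∃ U : Set X, IsOpen U ∧ p ∈ U ∧ ∀ x ∈ U, ¬ p ≤ x → inc p x ∈ W)
  isOpen_univ := ⟨by simp, fun _ => ⟨univ, isOpen_univ, trivial, fun _ _ _ => trivial⟩⟩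
  isOpen_inter := by
    rintro A B ⟨hA, hA'⟩ ⟨hB, hB'⟩
    refine ⟨hA.inter hB, fun h => ?_⟩
    obtain ⟨U, hU, hpU, h1⟩ := hA' h.1
    obtain ⟨V, hV, hpV, h2⟩ := hB' h.2
    exact ⟨U ∩ V, hU.inter hV, ⟨hpU, hpV⟩, fun x hx hn => ⟨h1 x hx.1 hn, h2 x hx.2 hn⟩⟩
  isOpen_sUnion := by
    intro S hS
    refine ⟨?_, ?_⟩
    · have : {x | inc p x ∈ ⋃₀ S} = ⋃ A ∈ S, {x | inc p x ∈ A} := by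
        ext x; simp
      rw [this]
      exact isOpen_biUnion fun A hA => (hS A hA).1
    · rintro ⟨A, hA, hpA⟩
      obtain ⟨U, hU, hpU, h1⟩ := (hS A hA).2 hpA
      exact ⟨U, hU, hpU, fun x hx hn => ⟨A, hA, h1 x hx hn⟩⟩

theorem isOpen_def {p : X} {W : Set (PExt p)} : IsOpen W ↔ IsOpen {x | inc p x ∈ W} ∧
    (pt p ∈ W → ∃ U : Set X, IsOpen U ∧ p ∈ U ∧ ∀ x ∈ U, ¬ p ≤ x → inc p x ∈ W) := Iff.rfl

instance [T1Space X] (p : X) : T1Space (PExt p) := by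
  refine ⟨fun a => ?_⟩
  rw [← isOpen_compl_iff, isOpen_def]
  rcases cases_pt a with rfl | ⟨y, rfl⟩
  · refine ⟨?_, fun h => absurd rfl h⟩
    have : {x | inc p x ∈ ({pt p}ᶜ : Set (PExt p))} = univ := by
      ext x; simp [inc_ne]
    rw [this]; exact isOpen_univ
  · have : {x | inc p x ∈ ({inc p y}ᶜ : Set (PExt p))} = {y}ᶜ := by
      ext x; simp [(inc_inj p).eq_iff]
    refine ⟨by rw [this]; exact isOpen_compl_singleton, fun _ => ?_⟩
    by_cases hy : p = y
    · refine ⟨univ, isOpen_univ, trivial, fun x _ hn h => hn ?_⟩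
      have h' := inc_inj p h
      rw [h', hy]
    · exact ⟨{y}ᶜ, isOpen_compl_singleton, hy, fun x hx _ h => hx (inc_inj p h)⟩

theorem isEmbedding_inc (p : X) : IsEmbedding (inc p) := by
  refine IsOpenEmbedding.isEmbedding (.of_continuous_injective_isOpenMap ?_ (inc_inj p) ?_)
  · exact continuous_def.2 fun W hW => hW.1
  · intro U hU
    rw [isOpen_def]
    constructor
    · have : {x | inc p x ∈ inc p '' U} = U := by
        ext x; simp [(inc_inj p).eq_iff]
      rwa [this]
    · rintro ⟨x, _, h⟩
      exact absurd h (inc_ne p x)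

theorem continuous_inf [T1Space X] (hsep : ∀ a : X, Continuous fun x : X => a ⊓ x) (p : X)
    (a : PExt p) : Continuous fun y : PExt p => a ⊓ y := by
  have hcl : IsOpen (Ici p)ᶜ := by
    have : Ici p = (fun x => p ⊓ x) ⁻¹' {p} := by
      ext x; simp
    rw [this]
    exact (isClosed_singleton.preimage (hsep p)).isOpen_compl
  refine continuous_def.2 fun W hW => ?_
  obtain ⟨hW1, hW2⟩ := isOpen_def.1 hW
  rw [isOpen_def]
  rcases cases_pt a with rfl | ⟨b, rfl⟩
  · have hA : IsOpen ((Ici p)ᶜ ∩ {x | inc p (p ⊓ x) ∈ W}) := hcl.inter (hW1.preimage (hsep p))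
    constructor
    · by_cases hp : pt p ∈ W
      · obtain ⟨U, hU, hpU, h⟩ := hW2 hp
        convert hA.union (hU.preimage (hsep p)) using 1
        ext x
        by_cases hx : p ≤ x
        · simp [pt_inf_of_le hx, hp, hx, hpU]
        · have := h (p ⊓ x)
          simp only [le_inf_iff, le_refl, true_and] at this
          simp [pt_inf_of_not_le hx, hx]
          exact fun h' => this h' hx
      · convert hA using 1
        ext x
        by_cases hx : p ≤ x
        · simp [pt_inf_of_le hx, hp, hx]
        · simp [pt_inf_of_not_le hx, hx]
    · intro hp
      have hp' : pt p ∈ W := by simpa using hp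
      obtain ⟨U, hU, hpU, h⟩ := hW2 hp'
      refine ⟨_, hU.preimage (hsep p), by simpa using hpU, fun x hx hn => ?_⟩
      change pt p ⊓ inc p x ∈ W
      rw [pt_inf_of_not_le hn]
      exact h _ hx fun h' => hn (h'.trans inf_le_right)
  · refine ⟨hW1.preimage (hsep b), fun hp => ?_⟩
    have hp' : pt p ⊓ inc p b ∈ W := by rw [inf_comm]; exact hp
    by_cases hb : p ≤ b
    · rw [pt_inf_of_le hb] at hp'
      obtain ⟨U, hU, hpU, h⟩ := hW2 hp'
      refine ⟨_, hU.preimage (hsep b), by simpa [hb] using hpU, fun x hx hn => ?_⟩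
      exact h _ hx fun h' => hn (h'.trans inf_le_right)
    · rw [pt_inf_of_not_le hb] at hp'
      refine ⟨_, hW1.preimage (hsep b), ?_, fun x hx _ => hx⟩
      change inc p (b ⊓ p) ∈ W
      rwa [inf_comm]

end PExt

/-- If `X` is a `T₁` semitopological semilattice such that every isomorphic topological
embedding of `X` into a `T₁` semitopological semilattice has closed image, then every
upper cone `↑p = {x : p ≤ x}` is open in `X`. -/
theorem stmt13 {X : Type u} [SemilatticeInf X] [TopologicalSpace X] [T1Space X]
    (hsep₁ : ∀ a : X, Continuous fun x : X => a ⊓ x)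
    (hsep₂ : ∀ a : X, Continuous fun x : X => x ⊓ a)
    (H : ∀ (Y : Type u) [SemilatticeInf Y] [TopologicalSpace Y] [T1Space Y],
      (∀ a : Y, Continuous fun y : Y => a ⊓ y) →
      (∀ a : Y, Continuous fun y : Y => y ⊓ a) →
      ∀ f : X → Y, (∀ a b : X, f (a ⊓ b) = f a ⊓ f b) → IsEmbedding f →
        IsClosed (Set.range f)) :
    ∀ p : X, IsOpen (Set.Ici p) := by
  intro p
  have hc := H (PExt p) (PExt.continuous_inf hsep₁ p)
    (fun a => by simpa only [inf_comm] using PExt.continuous_inf hsep₁ p a)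
    (PExt.inc p) (PExt.inc_inf p) (PExt.isEmbedding_inc p)
  obtain ⟨U, hU, hpU, h⟩ := (PExt.isOpen_def.1 hc.isOpen_compl).2 (by
    rintro ⟨x, hx⟩
    exact PExt.inc_ne p x hx)
  have hUp : ∀ x ∈ U, p ≤ x := fun x hx => by
    by_contra hn
    exact h x hx hn ⟨x, rfl⟩
  have : Ici p = (fun x => p ⊓ x) ⁻¹' U := by
    ext x
    constructor
    · intro hx
      have hx' : p ⊓ x = p := inf_eq_left.2 hx
      simpa [hx'] using hpU
    · intro hx
      exact (hUp _ hx).trans inf_le_right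
  rw [this]
  exact hU.preimage (hsep₁ p)
end
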